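/- Let u₀ ∈ L^∞(ℝⁿ;ℝⁿ) be divergence-free and suppose the mild solution u of the Navier–Stokes equations with initial datum u₀ has maximal existence interval (0,T) with T < ∞; that is, u ∈ L^∞(ℝⁿ×(0,T'); ℝⁿ) is a mild solution for every T' < T, and ‖u‖_{L^∞(ℝⁿ×(0,T'))} → ∞ as T' ↗ T. Then there exists an ancient mild solution v of the Navier–Stokes equations in ℝⁿ×(−∞,0) such that |v| ≤ 1 everywhere in ℝⁿ×(−∞,0) and |v(0,0)| = 1 (where v denotes the smooth representative); in particular, v is not identically zero. -/

import Mathlib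

open MeasureTheory Real Filter Topology

noncomputable section

/-- Euclidean space ℝⁿ. -/
abbrev Euc (n : ℕ) := EuclideanSpace ℝ (Fin n)

/-- The heat kernel Γ(x,t) = (4πt)^{-n/2} exp(-|x|²/(4t)). -/
noncomputable def heatKer (n : ℕ) (x : Euc n) (t : ℝ) : ℝ :=
  (4 * π * t) ^ (-(n : ℝ) / 2) * Real.exp (-‖x‖ ^ 2 / (4 * t))

/-- The fundamental solution G of the Laplacian on ℝⁿ (n ≥ 2). -/
noncomputable def lapFund (n : ℕ) (x : Euc n) : ℝ :=
  if n = 2 then (2 * π)⁻¹ * Real.log ‖x‖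
  else -((((n : ℝ) - 2) * (2 * π ^ ((n : ℝ) / 2) / Real.Gamma ((n : ℝ) / 2)))⁻¹) *
      ‖x‖ ^ (2 - (n : ℝ))

/-- The generating function Φ(x,t) = ∫_{ℝⁿ} G(y) Γ(x-y,t) dy. -/
noncomputable def genPhi (n : ℕ) (x : Euc n) (t : ℝ) : ℝ :=
  ∫ y : Euc n, lapFund n y * heatKer n (x - y) t

/-- Spatial partial derivative ∂f/∂x_i of a scalar function on ℝⁿ. -/
noncomputable def pd (n : ℕ) (i : Fin n) (f : Euc n → ℝ) (x : Euc n) : ℝ :=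
  fderiv ℝ f x (EuclideanSpace.single i 1)

/-- The Laplacian of a scalar function on ℝⁿ. -/
noncomputable def lap (n : ℕ) (f : Euc n → ℝ) (x : Euc n) : ℝ :=
  ∑ i : Fin n, pd n i (pd n i f) x

/-- The Oseen kernel K_{ij} = (-δ_{ij}Δ + ∂²/∂x_i∂x_j)Φ. -/
noncomputable def Kmat (n : ℕ) (i j : Fin n) (x : Euc n) (t : ℝ) : ℝ :=
  (if i = j then -(lap n (fun y => genPhi n y t) x) else 0)
    + pd n i (pd n j (fun y => genPhi n y t)) x

/-- The kernel K_{ijk} = ∂K_{ij}/∂x_k. -/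
noncomputable def Kten (n : ℕ) (i j k : Fin n) (x : Euc n) (t : ℝ) : ℝ :=
  pd n k (fun y => Kmat n i j y t) x

/-- Mild solution of the Navier–Stokes equations on ℝⁿ × (t₀,t₁) with initial datum u₀:
u_i(x,t) = ∫ Γ(x-y,t-t₀) u₀ᵢ(y) dy - ∫_{t₀}^t ∫ K_{ijk}(x-y,t-s) u_k u_j dy ds. -/
def IsMildNS (n : ℕ) (t₀ t₁ : ℝ) (u₀ : Euc n → Euc n) (u : Euc n → ℝ → Euc n) : Prop :=
  ∀ x : Euc n, ∀ t : ℝ, t ∈ Set.Ioo t₀ t₁ → ∀ i : Fin n,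
    u x t i = (∫ y : Euc n, heatKer n (x - y) (t - t₀) * u₀ y i)
      - ∫ s in Set.Ioo t₀ t, ∫ y : Euc n,
          ∑ j : Fin n, ∑ k : Fin n, Kten n i j k (x - y) (t - s) * u y s k * u y s j

/-- Spatial partial derivative for functions on space-time ℝⁿ × ℝ. -/
noncomputable def pdx (n : ℕ) (i : Fin n) (g : Euc n × ℝ → ℝ) (p : Euc n × ℝ) : ℝ :=
  fderiv ℝ g p (EuclideanSpace.single i 1, 0)

/-- Time derivative for functions on space-time ℝⁿ × ℝ. -/
noncomputable def pdt (n : ℕ) (g : Euc n × ℝ → ℝ) (p : Euc n × ℝ) : ℝ :=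
  fderiv ℝ g p (0, 1)

/-- Spatial Laplacian for functions on space-time ℝⁿ × ℝ. -/
noncomputable def lapx (n : ℕ) (g : Euc n × ℝ → ℝ) (p : Euc n × ℝ) : ℝ :=
  ∑ i : Fin n, pdx n i (pdx n i g) p

/-- An ancient mild solution of the Navier–Stokes equations: a bounded measurable
u : ℝⁿ × (-∞,0) → ℝⁿ for which there is a sequence T_l → -∞ such that u restricted to
ℝⁿ × (T_l,0) is a mild solution with initial datum u(·,T_l). -/
def IsAncientMild (n : ℕ) (u : Euc n → ℝ → Euc n) : Prop :=
  Measurable (fun q : Euc n × ℝ => u q.1 q.2) ∧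
  (∃ C : ℝ, ∀ x : Euc n, ∀ t < (0:ℝ), ‖u x t‖ ≤ C) ∧
  ∃ S : ℕ → ℝ, Filter.Tendsto S Filter.atTop Filter.atBot ∧
    ∀ l, S l < 0 ∧ IsMildNS n (S l) 0 (fun x => u x (S l)) u

/-- The radial profiles of the heat kernel and of its spatial derivatives. -/
def gK (n m : ℕ) (ρ s : ℝ) : ℝ :=
  (4 * π * s) ^ (-(n : ℝ) / 2) * ((2 * s)⁻¹) ^ m * Real.exp (-ρ / (4 * s))

theorem heatKer_eq_gK (n : ℕ) (x : Euc n) (t : ℝ) : heatKer n x t = gK n 0 (‖x‖ ^ 2) t := by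
  simp [heatKer, gK]

theorem heatKer_pos (n : ℕ) (x : Euc n) {t : ℝ} (ht : 0 < t) : 0 < heatKer n x t := by
  unfold heatKer; positivity

theorem heatKer_le (n : ℕ) (x : Euc n) {t : ℝ} (ht : 0 < t) :
    heatKer n x t ≤ (4 * π * t) ^ (-(n : ℝ) / 2) := by
  unfold heatKer
  refine mul_le_of_le_one_right (by positivity) (Real.exp_le_one_iff.2 ?_)
  rw [neg_div]
  exact neg_nonpos.2 (by positivity)

theorem measurable_heatKer (n : ℕ) : Measurable (fun q : Euc n × ℝ => heatKer n q.1 q.2) := by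
  unfold heatKer; fun_prop

theorem integrable_gauss (n : ℕ) {b : ℝ} (hb : 0 < b) :
    Integrable (fun x : Euc n => Real.exp (-b * ‖x‖ ^ 2)) := by
  have h := (GaussianFourier.integrable_cexp_neg_mul_sq_norm_add (V := Euc n) (b := (b : ℂ))
    (by simpa) 0 0).re
  refine h.congr (Eventually.of_forall fun x => ?_)
  simp only [zero_mul, add_zero, RCLike.re_eq_complex_re]
  rw [← Complex.exp_ofReal_re]
  push_cast; rfl

theorem integral_gauss (n : ℕ) {b : ℝ} (hb : 0 < b) :
    ∫ x : Euc n, Real.exp (-b * ‖x‖ ^ 2) = (π / b) ^ ((n : ℝ) / 2) := by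
  rw [GaussianFourier.integral_rexp_neg_mul_sq_norm hb]; simp

theorem heatKer_eq_gauss (n : ℕ) (x : Euc n) (t : ℝ) :
    heatKer n x t = (4 * π * t) ^ (-(n : ℝ) / 2) * Real.exp (-(4 * t)⁻¹ * ‖x‖ ^ 2) := by
  unfold heatKer; congr 2; rw [div_eq_mul_inv]; ring

theorem integrable_heatKer (n : ℕ) {t : ℝ} (ht : 0 < t) :
    Integrable (fun x : Euc n => heatKer n x t) := by
  simp_rw [heatKer_eq_gauss]
  exact (integrable_gauss n (by positivity)).const_mul _

theorem integral_heatKer (n : ℕ) {t : ℝ} (ht : 0 < t) : ∫ x : Euc n, heatKer n x t = 1 := by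
  simp_rw [heatKer_eq_gauss]
  rw [integral_const_mul, integral_gauss n (by positivity), neg_div, Real.rpow_neg (by positivity)]
  have : π / (4 * t)⁻¹ = 4 * π * t := by field_simp
  rw [this]
  exact inv_mul_cancel₀ (by positivity)

theorem integrable_heatKer_sub (n : ℕ) (x : Euc n) {t : ℝ} (ht : 0 < t) :
    Integrable (fun y : Euc n => heatKer n (x - y) t) :=
  (integrable_heatKer n ht).comp_sub_left x

theorem integral_heatKer_sub (n : ℕ) (x : Euc n) {t : ℝ} (ht : 0 < t) :
    ∫ y : Euc n, heatKer n (x - y) t = 1 := by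
  rw [integral_sub_left_eq_self (fun y => heatKer n y t) volume x, integral_heatKer n ht]

theorem gauss_prod_exponent (n : ℕ) (x y : Euc n) {a b : ℝ} (ha : 0 < a) (hb : 0 < b) :
    -‖x - y‖ ^ 2 / (4 * a) + -‖y‖ ^ 2 / (4 * b)
      = -((a + b) / (4 * a * b)) * ‖y - (b / (a + b)) • x‖ ^ 2 + -‖x‖ ^ 2 / (4 * (a + b)) := by
  rw [@norm_sub_sq_real, @norm_sub_sq_real, norm_smul, inner_smul_right, real_inner_comm x y,
    Real.norm_of_nonneg (by positivity)]
  field_simp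
  ring

theorem heatKer_semigroup (n : ℕ) (x : Euc n) {a b : ℝ} (ha : 0 < a) (hb : 0 < b) :
    ∫ y : Euc n, heatKer n (x - y) a * heatKer n y b = heatKer n x (a + b) := by
  have h : ∀ y : Euc n, heatKer n (x - y) a * heatKer n y b
      = ((4 * π * a) ^ (-(n : ℝ) / 2) * (4 * π * b) ^ (-(n : ℝ) / 2) *
          Real.exp (-‖x‖ ^ 2 / (4 * (a + b)))) *
        Real.exp (-((a + b) / (4 * a * b)) * ‖y - (b / (a + b)) • x‖ ^ 2) := by
    intro y
    have := gauss_prod_exponent n x y ha hb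
    unfold heatKer
    rw [mul_mul_mul_comm, ← Real.exp_add, this, Real.exp_add]
    ring
  simp_rw [h]
  rw [integral_const_mul,
    integral_sub_right_eq_self (fun y : Euc n => Real.exp (-((a + b) / (4 * a * b)) * ‖y‖ ^ 2)),
    integral_gauss n (by positivity)]
  unfold heatKer
  rw [mul_right_comm]
  congr 1
  rw [← Real.mul_rpow (by positivity) (by positivity), neg_div, Real.rpow_neg (by positivity),
    Real.rpow_neg (by positivity), ← Real.inv_rpow (by positivity),
    ← Real.mul_rpow (by positivity) (by positivity), ← Real.inv_rpow (by positivity)]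
  congr 1
  field_simp

theorem integral_heatKer_mul_heatKer (n : ℕ) (x z : Euc n) {a b : ℝ} (ha : 0 < a) (hb : 0 < b) :
    ∫ y : Euc n, heatKer n (x - y) a * heatKer n (y - z) b = heatKer n (x - z) (a + b) := by
  rw [← heatKer_semigroup n (x - z) ha hb,
    ← integral_sub_right_eq_self (fun y : Euc n => heatKer n (x - z - y) a * heatKer n y b) z]
  simp

theorem gK_nonneg (n m : ℕ) (ρ : ℝ) {s : ℝ} (hs : 0 < s) : 0 ≤ gK n m ρ s := by
  unfold gK; positivity

theorem hasDerivAt_gK (n m : ℕ) (ρ s : ℝ) :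
    HasDerivAt (fun r => gK n m r s) (-(1 / 2) * gK n (m + 1) ρ s) ρ := by
  unfold gK
  have h : HasDerivAt (fun r : ℝ => -r / (4 * s)) (-1 / (4 * s)) ρ :=
    ((hasDerivAt_id ρ).neg).div_const _
  refine ((h.exp).const_mul ((4 * π * s) ^ (-(n : ℝ) / 2) * ((2 * s)⁻¹) ^ m)).congr_deriv ?_
  rw [pow_succ, mul_inv, div_eq_mul_inv (-1 : ℝ), mul_inv]
  ring

theorem measurable_gK (n m : ℕ) : Measurable (fun q : ℝ × ℝ => gK n m q.1 q.2) := by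
  unfold gK; fun_prop

theorem pow_mul_exp_bound (m : ℕ) {a r : ℝ} (ha : 0 < a) (hr : 0 ≤ r) :
    r ^ m * Real.exp (-r ^ 2 / a) ≤ m.factorial * Real.exp a := by
  have h1 : r ^ m ≤ m.factorial * Real.exp r := by
    have := Real.pow_div_factorial_le_exp r hr m
    rwa [div_le_iff₀' (by positivity)] at this
  have h2 : r + -r ^ 2 / a ≤ a := by
    have : a - (r + -r ^ 2 / a) = ((r - a / 2) ^ 2 + 3 / 4 * a ^ 2) / a := by field_simp; ring
    have h3 : 0 ≤ ((r - a / 2) ^ 2 + 3 / 4 * a ^ 2) / a := by positivity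
    linarith
  calc _ ≤ m.factorial * Real.exp r * Real.exp (-r ^ 2 / a) := by gcongr
    _ = m.factorial * Real.exp (r + -r ^ 2 / a) := by rw [Real.exp_add]; ring
    _ ≤ _ := by gcongr

/-- First derivatives of `x ↦ f 0 (‖x‖ ^ 2)` when `(f m)' = -(1 / 2) * f (m + 1)`. -/
def radD1 (n : ℕ) (f : ℕ → ℝ → ℝ) (j : Fin n) (x : Euc n) : ℝ := -(x j * f 1 (‖x‖ ^ 2))

/-- Second derivatives of `x ↦ f 0 (‖x‖ ^ 2)` when `(f m)' = -(1 / 2) * f (m + 1)`. -/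
def radD2 (n : ℕ) (f : ℕ → ℝ → ℝ) (i j : Fin n) (x : Euc n) : ℝ :=
  (if i = j then -f 1 (‖x‖ ^ 2) else 0) + x i * x j * f 2 (‖x‖ ^ 2)

/-- Third derivatives of `x ↦ f 0 (‖x‖ ^ 2)` when `(f m)' = -(1 / 2) * f (m + 1)`. -/
def radD3 (n : ℕ) (f : ℕ → ℝ → ℝ) (i j k : Fin n) (x : Euc n) : ℝ :=
  ((if i = j then x k else 0) + (if i = k then x j else 0) + (if j = k then x i else 0))
    * f 2 (‖x‖ ^ 2) - x i * x j * x k * f 3 (‖x‖ ^ 2)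

theorem hasFDerivAt_radial (n : ℕ) {f : ℝ → ℝ} {f' : ℝ} {x : Euc n}
    (h : HasDerivAt f f' (‖x‖ ^ 2)) :
    HasFDerivAt (fun y : Euc n => f (‖y‖ ^ 2)) (f' • (2 • innerSL ℝ x)) x :=
  h.comp_hasFDerivAt x (hasStrictFDerivAt_norm_sq x).hasFDerivAt

theorem hasFDerivAt_coord (n : ℕ) (j : Fin n) (x : Euc n) :
    HasFDerivAt (fun y : Euc n => y j) (EuclideanSpace.proj (𝕜 := ℝ) j : Euc n →L[ℝ] ℝ) x :=
  (EuclideanSpace.proj (𝕜 := ℝ) j : Euc n →L[ℝ] ℝ).hasFDerivAt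

theorem exists_hasFDerivAt_rad0 (n : ℕ) {f : ℕ → ℝ → ℝ}
    (hf : ∀ m, ∀ ρ, 0 ≤ ρ → HasDerivAt (f m) (-(1 / 2) * f (m + 1) ρ) ρ) (x : Euc n) :
    ∃ L : Euc n →L[ℝ] ℝ, HasFDerivAt (fun y : Euc n => f 0 (‖y‖ ^ 2)) L x ∧
      ∀ j, L (EuclideanSpace.single j 1) = radD1 n f j x := by
  refine ⟨_, hasFDerivAt_radial n (hf 0 _ (by positivity)), fun j => ?_⟩
  simp [radD1, EuclideanSpace.inner_single_right]
  ring

theorem exists_hasFDerivAt_radD1 (n : ℕ) {f : ℕ → ℝ → ℝ}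
    (hf : ∀ m, ∀ ρ, 0 ≤ ρ → HasDerivAt (f m) (-(1 / 2) * f (m + 1) ρ) ρ) (j : Fin n) (x : Euc n) :
    ∃ L : Euc n →L[ℝ] ℝ, HasFDerivAt (radD1 n f j) L x ∧
      ∀ i, L (EuclideanSpace.single i 1) = radD2 n f i j x := by
  refine ⟨_, ((hasFDerivAt_coord n j x).mul
    (hasFDerivAt_radial n (hf 1 (‖x‖ ^ 2) (by positivity)))).neg, fun i => ?_⟩
  simp [radD2, EuclideanSpace.inner_single_right, eq_comm]
  split_ifs <;> ring

theorem exists_hasFDerivAt_radD2 (n : ℕ) {f : ℕ → ℝ → ℝ}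
    (hf : ∀ m, ∀ ρ, 0 ≤ ρ → HasDerivAt (f m) (-(1 / 2) * f (m + 1) ρ) ρ) (i j : Fin n)
    (x : Euc n) :
    ∃ L : Euc n →L[ℝ] ℝ, HasFDerivAt (radD2 n f i j) L x ∧
      ∀ k, L (EuclideanSpace.single k 1) = radD3 n f i j k x := by
  have h1 := hasFDerivAt_radial n (hf 1 (‖x‖ ^ 2) (by positivity))
  have h2 := ((hasFDerivAt_coord n i x).mul (hasFDerivAt_coord n j x)).mul
    (hasFDerivAt_radial n (hf 2 (‖x‖ ^ 2) (by positivity)))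
  by_cases hij : i = j
  · refine ⟨_, (h1.neg.add h2).congr_of_eventuallyEq (Eventually.of_forall fun y => ?_),
      fun k => ?_⟩
    · simp [radD2, hij]
    · simp [radD3, EuclideanSpace.inner_single_right, hij]
      split_ifs <;> ring
  · refine ⟨_, h2.congr_of_eventuallyEq (Eventually.of_forall fun y => ?_), fun k => ?_⟩
    · simp [radD2, hij]
    · simp [radD3, EuclideanSpace.inner_single_right, hij]
      split_ifs <;> ring

theorem pd_rad0 (n : ℕ) {f : ℕ → ℝ → ℝ}
    (hf : ∀ m, ∀ ρ, 0 ≤ ρ → HasDerivAt (f m) (-(1 / 2) * f (m + 1) ρ) ρ) (j : Fin n) :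
    pd n j (fun y : Euc n => f 0 (‖y‖ ^ 2)) = radD1 n f j := by
  funext x
  obtain ⟨L, hL, h⟩ := exists_hasFDerivAt_rad0 n hf x
  rw [pd, hL.fderiv, h]

theorem pd_radD1 (n : ℕ) {f : ℕ → ℝ → ℝ}
    (hf : ∀ m, ∀ ρ, 0 ≤ ρ → HasDerivAt (f m) (-(1 / 2) * f (m + 1) ρ) ρ) (i j : Fin n) :
    pd n i (radD1 n f j) = radD2 n f i j := by
  funext x
  obtain ⟨L, hL, h⟩ := exists_hasFDerivAt_radD1 n hf j x
  rw [pd, hL.fderiv, h]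

theorem Kten_of_radial (n : ℕ) {f : ℕ → ℝ → ℝ} {t : ℝ}
    (hf : ∀ m, ∀ ρ, 0 ≤ ρ → HasDerivAt (f m) (-(1 / 2) * f (m + 1) ρ) ρ)
    (hΦ : ∀ x : Euc n, genPhi n x t = f 0 (‖x‖ ^ 2)) (i j k : Fin n) (x : Euc n) :
    Kten n i j k x t = (if i = j then -∑ m, radD3 n f m m k x else 0) + radD3 n f i j k x := by
  have e : (fun y => Kmat n i j y t)
      = fun y => (if i = j then -∑ m, radD2 n f m m y else 0) + radD2 n f i j y := by
    funext y
    simp_rw [Kmat, lap, hΦ, pd_rad0 n hf, pd_radD1 n hf]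
  rw [Kten, e]
  choose L hL h using fun (a b : Fin n) => exists_hasFDerivAt_radD2 n hf a b x
  by_cases hij : i = j
  · simp only [hij, if_true]
    have hs : HasFDerivAt (fun y => -∑ m, radD2 n f m m y + radD2 n f j j y)
        (-∑ m, L m m + L j j) x :=
      (HasFDerivAt.fun_sum fun m _ => hL m m).neg.add (hL j j)
    rw [pd, hs.fderiv]
    simp [h]
  · simp only [hij, if_false, zero_add]
    rw [pd]
    exact (congrArg (fun M => M (EuclideanSpace.single k 1)) (hL i j).fderiv).trans (h i j k)

theorem gK_le_of_le (n m : ℕ) {q ρ s : ℝ} (hs : 0 < s) (h : q ≤ ρ) : gK n m ρ s ≤ gK n m q s := by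
  unfold gK
  gcongr

theorem gK_le_inv (n m : ℕ) (hn : 2 ≤ n) {ρ s : ℝ} (hρ : 0 ≤ ρ) (hs : 1 ≤ s) :
    gK n m ρ s ≤ s⁻¹ ^ (m + 1) := by
  have hs0 : 0 < s := by linarith
  have h1 : 1 ≤ 4 * π * s := by nlinarith [Real.pi_gt_three]
  have hn' : (2 : ℝ) ≤ n := by exact_mod_cast hn
  have e1 : (4 * π * s) ^ (-(n : ℝ) / 2) ≤ s⁻¹ := by
    calc _ ≤ (4 * π * s) ^ (-1 : ℝ) := Real.rpow_le_rpow_of_exponent_le h1 (by linarith)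
      _ = (4 * π * s)⁻¹ := Real.rpow_neg_one _
      _ ≤ s⁻¹ := by gcongr; nlinarith [Real.pi_gt_three]
  have e2 : (2 * s)⁻¹ ≤ s⁻¹ := by gcongr; linarith
  have e3 : Real.exp (-ρ / (4 * s)) ≤ 1 :=
    Real.exp_le_one_iff.2 (by rw [neg_div]; exact neg_nonpos.2 (by positivity))
  calc gK n m ρ s ≤ s⁻¹ * s⁻¹ ^ m * 1 := by unfold gK; gcongr
    _ = _ := by ring

theorem exists_gK_le (n m : ℕ) {q : ℝ} (hq : 0 < q) :
    ∃ C, ∀ s ∈ Set.Ioc (0 : ℝ) 1, gK n m q s ≤ C := by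
  refine ⟨(4 * π) ^ (-(n : ℝ) / 2) * ((n + m).factorial * (4 / q) ^ (n + m)), fun s hs => ?_⟩
  have hs0 := hs.1
  have h1 := Real.pow_div_factorial_le_exp (q / (4 * s)) (by positivity) (n + m)
  rw [div_le_iff₀ (by positivity)] at h1
  have e1 : s ^ (-(n : ℝ) / 2) ≤ s⁻¹ ^ n := by
    rw [inv_pow, ← Real.rpow_natCast s n, ← Real.rpow_neg hs0.le]
    refine Real.rpow_le_rpow_of_exponent_ge hs0 hs.2 ?_
    have : (0 : ℝ) ≤ n := n.cast_nonneg
    linarith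
  have e2 : (2 * s)⁻¹ ≤ s⁻¹ := by gcongr; linarith
  have e3 : s⁻¹ ^ (n + m) ≤ (n + m).factorial * (4 / q) ^ (n + m) * Real.exp (q / (4 * s)) := by
    have : s⁻¹ ^ (n + m) = (4 / q) ^ (n + m) * (q / (4 * s)) ^ (n + m) := by
      rw [← mul_pow]; congr 1; field_simp
    rw [this]
    calc _ ≤ (4 / q) ^ (n + m) * (Real.exp (q / (4 * s)) * (n + m).factorial) := by gcongr
      _ = _ := by ring
  have e4 : Real.exp (q / (4 * s)) * Real.exp (-q / (4 * s)) = 1 := by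
    rw [← Real.exp_add, neg_div, add_neg_cancel, Real.exp_zero]
  calc gK n m q s ≤ (4 * π) ^ (-(n : ℝ) / 2) * s⁻¹ ^ n * s⁻¹ ^ m * Real.exp (-q / (4 * s)) := by
        unfold gK
        rw [Real.mul_rpow (by positivity) hs0.le]
        gcongr
    _ = (4 * π) ^ (-(n : ℝ) / 2) * (s⁻¹ ^ (n + m) * Real.exp (-q / (4 * s))) := by
        rw [pow_add]; ring
    _ ≤ (4 * π) ^ (-(n : ℝ) / 2) * ((n + m).factorial * (4 / q) ^ (n + m)
          * Real.exp (q / (4 * s)) * Real.exp (-q / (4 * s))) := by gcongr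
    _ = _ := by rw [mul_assoc ((n + m).factorial * (4 / q) ^ (n + m)), e4, mul_one]

theorem integrableOn_Ioi_zero_of_bounds {f : ℝ → ℝ} (hf : Measurable f) {C C' : ℝ}
    (h1 : ∀ s ∈ Set.Ioc (0 : ℝ) 1, |f s| ≤ C) (h2 : ∀ s, 1 ≤ s → |f s| ≤ C' * s⁻¹ ^ 2) :
    IntegrableOn f (Set.Ioi 0) := by
  rw [← Set.Ioc_union_Ioi_eq_Ioi (zero_le_one (α := ℝ))]
  refine IntegrableOn.union ?_ ?_
  · refine Measure.integrableOn_of_bounded (M := C) (by simp) hf.aestronglyMeasurable ?_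
    exact (ae_restrict_iff' measurableSet_Ioc).2 (Eventually.of_forall fun s hs => h1 s hs)
  · have h3 : IntegrableOn (fun s : ℝ => C' * s⁻¹ ^ 2) (Set.Ioi 1) := by
      refine Integrable.const_mul ?_ _
      refine (integrableOn_Ioi_rpow_of_lt (a := -2) (by norm_num) zero_lt_one).congr_fun ?_
        measurableSet_Ioi
      intro s hs
      have hs0 : (0 : ℝ) < s := lt_trans zero_lt_one hs
      simp only
      rw [Real.rpow_neg hs0.le, inv_pow]
      norm_num
    refine h3.mono' hf.aestronglyMeasurable ?_
    exact (ae_restrict_iff' measurableSet_Ioi).2 (Eventually.of_forall fun s hs => h2 s (le_of_lt hs))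

theorem measurable_gK_right (n m : ℕ) (ρ : ℝ) : Measurable (gK n m ρ) :=
  (measurable_gK n m).comp (measurable_const.prodMk measurable_id)

theorem integrableOn_gK_one (n : ℕ) (hn : 2 ≤ n) {q : ℝ} (hq : 0 < q) :
    IntegrableOn (gK n 1 q) (Set.Ioi 0) := by
  obtain ⟨C, hC⟩ := exists_gK_le n 1 hq
  refine integrableOn_Ioi_zero_of_bounds (C := C) (C' := 1) (measurable_gK_right _ _ _) ?_ ?_
  · intro s hs
    rw [abs_of_nonneg (gK_nonneg _ _ _ hs.1)]
    exact hC s hs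
  · intro s hs
    rw [abs_of_nonneg (gK_nonneg _ _ _ (by linarith)), one_mul]
    exact gK_le_inv n 1 hn hq.le hs

theorem abs_gK_zero_sub_le (n : ℕ) (hn : 2 ≤ n) {ρ s : ℝ} (hρ : 0 ≤ ρ) (hs : 1 ≤ s) :
    |gK n 0 ρ s - gK n 0 1 s| ≤ (ρ + 1) * s⁻¹ ^ 2 := by
  have hs0 : 0 < s := by linarith
  have e0 := gK_le_inv n 0 hn (le_refl (0 : ℝ)) hs
  have e1 : ∀ r : ℝ, 0 ≤ r → gK n 0 r s ≤ gK n 0 0 s ∧ gK n 0 0 s * (1 - r / (4 * s)) ≤ gK n 0 r s := by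
    intro r hr
    refine ⟨gK_le_of_le n 0 hs0 hr, ?_⟩
    have h1 := Real.add_one_le_exp (-r / (4 * s))
    have h2 : gK n 0 r s = gK n 0 0 s * Real.exp (-r / (4 * s)) := by simp [gK]
    rw [h2]
    refine mul_le_mul_of_nonneg_left ?_ (gK_nonneg _ _ _ hs0)
    rw [neg_div] at h1 ⊢
    linarith
  have e2 : ∀ r : ℝ, 0 ≤ r → gK n 0 0 s * (r / (4 * s)) ≤ r * s⁻¹ ^ 2 := by
    intro r hr
    have : r / (4 * s) ≤ r * s⁻¹ := by
      rw [div_eq_mul_inv]; gcongr; linarith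
    calc _ ≤ s⁻¹ ^ (0 + 1) * (r * s⁻¹) := by gcongr
      _ = _ := by ring
  obtain ⟨a1, a2⟩ := e1 ρ hρ
  obtain ⟨b1, b2⟩ := e1 1 zero_le_one
  have a3 := e2 ρ hρ
  have b3 := e2 1 zero_le_one
  have h4 : 0 ≤ s⁻¹ ^ 2 := by positivity
  have h5 : 0 ≤ ρ * s⁻¹ ^ 2 := by positivity
  rw [abs_le]
  constructor <;> nlinarith

theorem integrableOn_gK_zero_sub (n : ℕ) (hn : 2 ≤ n) {ρ : ℝ} (hρ : 0 < ρ) :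
    IntegrableOn (fun s => gK n 0 ρ s - gK n 0 1 s) (Set.Ioi 0) := by
  obtain ⟨C, hC⟩ := exists_gK_le n 0 hρ
  obtain ⟨C', hC'⟩ := exists_gK_le n 0 zero_lt_one
  refine integrableOn_Ioi_zero_of_bounds (C := C + C') (C' := ρ + 1)
    ((measurable_gK_right _ _ _).sub (measurable_gK_right _ _ _)) ?_ ?_
  · intro s hs
    have h1 := hC s hs
    have h2 := hC' s hs
    have h3 := gK_nonneg n 0 ρ hs.1
    have h4 := gK_nonneg n 0 1 hs.1
    rw [abs_le]
    constructor <;> linarith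
  · intro s hs
    exact abs_gK_zero_sub_le n hn hρ.le hs

theorem integral_gK_one (n : ℕ) {ρ : ℝ} (hρ : 0 < ρ) :
    ∫ s in Set.Ioi (0 : ℝ), gK n 1 ρ s
      = ρ ^ (-(n : ℝ) / 2) * ∫ s in Set.Ioi (0 : ℝ), gK n 1 1 s := by
  have h := integral_comp_mul_left_Ioi (fun s => gK n 1 ρ s) 0 hρ
  rw [mul_zero, smul_eq_mul] at h
  have h2 : ∫ s in Set.Ioi (0 : ℝ), gK n 1 ρ (ρ * s)
      = ∫ s in Set.Ioi (0 : ℝ), ρ⁻¹ * ρ ^ (-(n : ℝ) / 2) * gK n 1 1 s := by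
    refine setIntegral_congr_fun measurableSet_Ioi fun s hs => ?_
    have hs0 : (0 : ℝ) < s := hs
    simp only [gK]
    rw [show 4 * π * (ρ * s) = ρ * (4 * π * s) by ring, Real.mul_rpow hρ.le (by positivity),
      show -ρ / (4 * (ρ * s)) = -1 / (4 * s) by field_simp,
      show (2 * (ρ * s))⁻¹ = ρ⁻¹ * (2 * s)⁻¹ by field_simp]
    ring
  rw [h2, integral_const_mul] at h
  have hρ' := hρ.ne'
  field_simp at h ⊢
  linarith

theorem integral_gK_one_pos (n : ℕ) (hn : 2 ≤ n) : 0 < ∫ s in Set.Ioi (0 : ℝ), gK n 1 1 s := by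
  rw [setIntegral_pos_iff_support_of_nonneg_ae
    ((ae_restrict_iff' measurableSet_Ioi).2 (Eventually.of_forall fun s hs => gK_nonneg n 1 1 hs))
    (integrableOn_gK_one n hn zero_lt_one)]
  have : Set.Ioi (0 : ℝ) ⊆ Function.support (gK n 1 1) ∩ Set.Ioi 0 := by
    intro s hs
    have hs0 : (0 : ℝ) < s := hs
    refine ⟨?_, hs⟩
    have : 0 < gK n 1 1 s := by unfold gK; positivity
    exact this.ne'
  exact lt_of_lt_of_le (by simp) (measure_mono this)

theorem hasDerivAt_integral_gK_sub (n : ℕ) (hn : 2 ≤ n) {ρ : ℝ} (hρ : 0 < ρ) :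
    HasDerivAt (fun r => ∫ s in Set.Ioi (0 : ℝ), (gK n 0 r s - gK n 0 1 s))
      (-(1 / 2) * ρ ^ (-(n : ℝ) / 2) * ∫ s in Set.Ioi (0 : ℝ), gK n 1 1 s) ρ := by
  have h := hasDerivAt_integral_of_dominated_loc_of_deriv_le
    (F := fun r s => gK n 0 r s - gK n 0 1 s) (F' := fun r s => -(1 / 2) * gK n 1 r s)
    (bound := gK n 1 (ρ / 2)) (μ := volume.restrict (Set.Ioi (0 : ℝ)))
    (Ioi_mem_nhds (show ρ / 2 < ρ by linarith))
    (Eventually.of_forall fun r => ((measurable_gK_right _ _ _).sub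
      (measurable_gK_right _ _ _)).aestronglyMeasurable)
    (integrableOn_gK_zero_sub n hn hρ)
    ((measurable_gK_right _ _ _).const_mul _).aestronglyMeasurable ?_
    (integrableOn_gK_one n hn (by positivity)) ?_
  · refine h.2.congr_deriv ?_
    rw [integral_const_mul, integral_gK_one n hρ]
    ring
  · refine (ae_restrict_iff' measurableSet_Ioi).2 (Eventually.of_forall fun s hs r hr => ?_)
    have h1 := gK_nonneg n 1 r hs
    have h2 := gK_le_of_le n 1 hs (le_of_lt hr)
    rw [Real.norm_eq_abs, abs_le]
    constructor <;> linarith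
  · refine Eventually.of_forall fun s r hr => ?_
    simpa using (hasDerivAt_gK n 0 r s).sub_const (gK n 0 1 s)

theorem exists_lapFund_eq (n : ℕ) (hn : 2 ≤ n) : ∃ c₀ c₁ : ℝ, ∀ y : Euc n, y ≠ 0 →
    lapFund n y = c₀ + c₁ * ∫ s in Set.Ioi (0 : ℝ), (gK n 0 (‖y‖ ^ 2) s - gK n 0 1 s) := by
  obtain ⟨Λ, B, hΛ, hd⟩ : ∃ (Λ : ℝ → ℝ) (B : ℝ), (∀ y : Euc n, y ≠ 0 → lapFund n y = Λ (‖y‖ ^ 2)) ∧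
      ∀ ρ, 0 < ρ → HasDerivAt Λ (B * ρ ^ (-(n : ℝ) / 2)) ρ := by
    by_cases h2 : n = 2
    · refine ⟨fun ρ => (4 * π)⁻¹ * Real.log ρ, (4 * π)⁻¹, fun y hy => ?_, fun ρ hρ => ?_⟩
      · simp only [lapFund, h2, if_true, Real.log_pow]
        push_cast
        field_simp
        norm_num
        ring
      · refine ((Real.hasDerivAt_log hρ.ne').const_mul _).congr_deriv ?_
        subst h2
        norm_num [Real.rpow_neg_one]
    · set A := ((((n : ℝ) - 2) * (2 * π ^ ((n : ℝ) / 2) / Real.Gamma ((n : ℝ) / 2)))⁻¹)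
      refine ⟨fun ρ => -A * ρ ^ (1 - (n : ℝ) / 2), -A * (1 - (n : ℝ) / 2), fun y hy => ?_,
        fun ρ hρ => ?_⟩
      · simp only [lapFund, h2, if_false]
        rw [← Real.rpow_natCast, ← Real.rpow_mul (norm_nonneg _)]
        congr 2
        push_cast
        ring
      · refine ((Real.hasDerivAt_rpow_const (Or.inl hρ.ne')).const_mul _).congr_deriv ?_
        rw [← mul_assoc]
        congr 2
        ring
  have hκ := integral_gK_one_pos n hn
  set κ := ∫ s in Set.Ioi (0 : ℝ), gK n 1 1 s
  have hF := fun ρ (hρ : 0 < ρ) => hasDerivAt_integral_gK_sub n hn hρ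
  set F := fun r => ∫ s in Set.Ioi (0 : ℝ), (gK n 0 r s - gK n 0 1 s)
  have hD : ∀ ρ, 0 < ρ → HasDerivAt (fun r => Λ r - (-2 * B / κ) * F r) 0 ρ := by
    intro ρ hρ
    refine ((hd ρ hρ).sub ((hF ρ hρ).const_mul _)).congr_deriv ?_
    field_simp
    ring
  have hconst : ∀ ρ, 0 < ρ → Λ ρ - (-2 * B / κ) * F ρ = Λ 1 - (-2 * B / κ) * F 1 := by
    intro ρ hρ
    exact isOpen_Ioi.is_const_of_deriv_eq_zero isPreconnected_Ioi
      (fun r hr => (hD r hr).differentiableAt.differentiableWithinAt)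
      (fun r hr => (hD r hr).deriv) hρ (Set.mem_Ioi.2 zero_lt_one)
  refine ⟨Λ 1 - (-2 * B / κ) * F 1, -2 * B / κ, fun y hy => ?_⟩
  rw [hΛ y hy]
  have := hconst (‖y‖ ^ 2) (by positivity)
  linarith

theorem norm_pow_mul_heatKer_le (n m : ℕ) (z : Euc n) {t : ℝ} (ht : 0 < t) :
    ‖z‖ ^ m * heatKer n z t
      ≤ (2 : ℝ) ^ ((n : ℝ) / 2) * (m.factorial * Real.exp 8) * √t ^ m * heatKer n z (2 * t) := by
  have hst : 0 < √t := Real.sqrt_pos.2 ht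
  have h := pow_mul_exp_bound m (a := 8) (r := ‖z‖ / √t) (by norm_num) (by positivity)
  have e1 : ‖z‖ ^ m = (‖z‖ / √t) ^ m * √t ^ m := by rw [← mul_pow, div_mul_cancel₀ _ hst.ne']
  have e2 : heatKer n z t = (2 : ℝ) ^ ((n : ℝ) / 2) * Real.exp (-(‖z‖ / √t) ^ 2 / 8)
      * heatKer n z (2 * t) := by
    unfold heatKer
    have a1 : (2 : ℝ) ^ ((n : ℝ) / 2) * (4 * π * (2 * t)) ^ (-(n : ℝ) / 2)
        = (4 * π * t) ^ (-(n : ℝ) / 2) := by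
      rw [show 4 * π * (2 * t) = 2 * (4 * π * t) by ring,
        Real.mul_rpow (by norm_num) (by positivity), ← mul_assoc, ← Real.rpow_add (by norm_num),
        neg_div, add_neg_cancel, Real.rpow_zero, one_mul]
    have a2 : Real.exp (-(‖z‖ / √t) ^ 2 / 8) * Real.exp (-‖z‖ ^ 2 / (4 * (2 * t)))
        = Real.exp (-‖z‖ ^ 2 / (4 * t)) := by
      rw [← Real.exp_add, div_pow, Real.sq_sqrt ht.le]
      congr 1
      field_simp
      ring
    rw [← a1, ← a2]
    ring
  have h0 := (heatKer_pos n z (t := 2 * t) (by positivity)).le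
  rw [e1, e2]
  calc _ = (2 : ℝ) ^ ((n : ℝ) / 2) * ((‖z‖ / √t) ^ m * Real.exp (-(‖z‖ / √t) ^ 2 / 8)) * √t ^ m
        * heatKer n z (2 * t) := by ring
    _ ≤ _ := by gcongr

theorem measurable_heatKer_left (n : ℕ) (t : ℝ) : Measurable (fun x : Euc n => heatKer n x t) :=
  (measurable_heatKer n).comp (measurable_id.prodMk measurable_const)

theorem integrable_norm_pow_mul_heatKer (n m : ℕ) {t : ℝ} (ht : 0 < t) :
    Integrable (fun z : Euc n => ‖z‖ ^ m * heatKer n z t) := by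
  refine ((integrable_heatKer n (t := 2 * t) (by positivity)).const_mul
    ((2 : ℝ) ^ ((n : ℝ) / 2) * (m.factorial * Real.exp 8) * √t ^ m)).mono'
    ((measurable_norm.pow_const m).mul (measurable_heatKer_left n t)).aestronglyMeasurable ?_
  refine Eventually.of_forall fun z => ?_
  rw [Real.norm_of_nonneg (mul_nonneg (by positivity) (heatKer_pos n z ht).le)]
  exact norm_pow_mul_heatKer_le n m z ht

theorem integrable_sq_mul_heatKer_sub (n : ℕ) (x : Euc n) {t : ℝ} (ht : 0 < t) :
    Integrable (fun y : Euc n => (‖y‖ ^ 2 + 1) * heatKer n (x - y) t) := by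
  have h1 := ((integrable_norm_pow_mul_heatKer n 2 ht).comp_sub_left x).const_mul 2
  have h2 := (integrable_heatKer_sub n x ht).const_mul (2 * ‖x‖ ^ 2 + 1)
  refine (h1.add h2).mono' (by
    have := (measurable_heatKer_left n t).comp (measurable_const_sub x)
    exact (((measurable_norm.pow_const 2).add_const 1).mul this).aestronglyMeasurable) ?_
  refine Eventually.of_forall fun y => ?_
  have h0 := (heatKer_pos n (x - y) ht).le
  rw [Real.norm_of_nonneg (by positivity)]
  have h3 : ‖y‖ ^ 2 ≤ 2 * ‖x - y‖ ^ 2 + 2 * ‖x‖ ^ 2 := by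
    have : ‖y‖ ≤ ‖x‖ + ‖x - y‖ := by
      calc ‖y‖ = ‖x - (x - y)‖ := by rw [sub_sub_cancel]
        _ ≤ _ := norm_sub_le _ _
    nlinarith [norm_nonneg y, norm_nonneg x, norm_nonneg (x - y), sq_nonneg (‖x‖ - ‖x - y‖)]
  simp only [Pi.add_apply]
  nlinarith

theorem integrable_genPhi_prod (n : ℕ) (hn : 2 ≤ n) (x : Euc n) {t : ℝ} (ht : 0 < t) :
    Integrable (fun p : Euc n × ℝ =>
        (gK n 0 (‖p.1‖ ^ 2) p.2 - gK n 0 1 p.2) * heatKer n (x - p.1) t)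
      (volume.prod (volume.restrict (Set.Ioi (0 : ℝ)))) := by
  have hm1 : Measurable (fun p : Euc n × ℝ => gK n 0 (‖p.1‖ ^ 2) p.2) :=
    (measurable_gK n 0).comp ((measurable_fst.norm.pow_const 2).prodMk measurable_snd)
  have hm2 : Measurable (fun p : Euc n × ℝ => gK n 0 1 p.2) :=
    (measurable_gK_right n 0 1).comp measurable_snd
  have hm3 : Measurable (fun p : Euc n × ℝ => heatKer n (x - p.1) t) :=
    (measurable_heatKer_left n t).comp (by fun_prop)
  have hm := (hm1.sub hm2).mul hm3
  have hΓ := integrable_heatKer_sub n x ht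
  have hpt : ∀ s, 0 < s → Integrable (fun y : Euc n =>
      heatKer n y s * heatKer n (x - y) t) := fun s hs =>
    hΓ.bdd_mul (c := (4 * π * s) ^ (-(n : ℝ) / 2))
      (measurable_heatKer_left n s).aestronglyMeasurable
      (Eventually.of_forall fun y => by
        rw [Real.norm_of_nonneg (heatKer_pos n y hs).le]; exact heatKer_le n y hs)
  have hsec : ∀ s, 0 < s → Integrable (fun y : Euc n =>
      (gK n 0 (‖y‖ ^ 2) s - gK n 0 1 s) * heatKer n (x - y) t) := by
    intro s hs
    refine ((hpt s hs).sub (hΓ.const_mul (gK n 0 1 s))).congr (Eventually.of_forall fun y => ?_)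
    simp only [Pi.sub_apply, heatKer_eq_gK n y s]
    ring
  refine (integrable_prod_iff' hm.aestronglyMeasurable).2
    ⟨(ae_restrict_iff' measurableSet_Ioi).2 (Eventually.of_forall fun s hs => hsec s hs), ?_⟩
  obtain ⟨C, hC⟩ := exists_gK_le n 0 zero_lt_one
  refine integrableOn_Ioi_zero_of_bounds (C := (4 * π * t) ^ (-(n : ℝ) / 2) + C)
    (C' := ∫ y : Euc n, (‖y‖ ^ 2 + 1) * heatKer n (x - y) t)
    hm.norm.stronglyMeasurable.integral_prod_left'.measurable ?_ ?_
  · intro s hs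
    have hs0 : 0 < s := hs.1
    rw [abs_of_nonneg (integral_nonneg fun y => norm_nonneg _)]
    calc _ ≤ ∫ y : Euc n, (heatKer n (x - y) t * heatKer n y s
            + gK n 0 1 s * heatKer n (x - y) t) := by
          refine integral_mono (hsec s hs0).norm (((hpt s hs0).congr
            (Eventually.of_forall fun y => mul_comm _ _)).add (hΓ.const_mul _)) fun y => ?_
          have h1 := (heatKer_pos n (x - y) ht).le
          have h2 := (heatKer_pos n y hs0).le
          have h3 := gK_nonneg n 0 1 hs0
          simp only [Pi.mul_apply, Pi.sub_apply, norm_mul, Real.norm_eq_abs]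
          rw [abs_of_nonneg h1, ← heatKer_eq_gK, mul_comm (heatKer n (x - y) t), ← add_mul]
          refine mul_le_mul_of_nonneg_right ?_ h1
          rw [abs_le]
          constructor <;> linarith
      _ = heatKer n x (t + s) + gK n 0 1 s := by
          rw [integral_add ((hpt s hs0).congr
            (Eventually.of_forall fun y => mul_comm _ _)) (hΓ.const_mul _),
            heatKer_semigroup n x ht hs0, integral_const_mul, integral_heatKer_sub n x ht, mul_one]
      _ ≤ _ := by
          refine add_le_add ((heatKer_le n x (by linarith)).trans ?_) (hC s hs)
          refine Real.rpow_le_rpow_of_nonpos (by positivity) (by gcongr; linarith) ?_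
          have : (0 : ℝ) ≤ n := n.cast_nonneg
          linarith
  · intro s hs
    have hs0 : 0 < s := by linarith
    rw [abs_of_nonneg (integral_nonneg fun y => norm_nonneg _), ← integral_mul_const]
    refine integral_mono (hsec s hs0).norm ((integrable_sq_mul_heatKer_sub n x ht).mul_const _)
      fun y => ?_
    have h1 := (heatKer_pos n (x - y) ht).le
    have h2 := abs_gK_zero_sub_le n hn (sq_nonneg ‖y‖) hs
    simp only [Pi.mul_apply, Pi.sub_apply, norm_mul, Real.norm_eq_abs]
    rw [abs_of_nonneg h1, mul_right_comm]
    exact mul_le_mul_of_nonneg_right h2 h1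

theorem genPhi_section (n : ℕ) (x : Euc n) {t s : ℝ} (ht : 0 < t) (hs : 0 < s) :
    ∫ y : Euc n, (gK n 0 (‖y‖ ^ 2) s - gK n 0 1 s) * heatKer n (x - y) t
      = gK n 0 (‖x‖ ^ 2) (t + s) - gK n 0 1 s := by
  have hΓ := integrable_heatKer_sub n x ht
  have h1 : Integrable (fun y : Euc n => heatKer n (x - y) t * heatKer n y s) :=
    hΓ.mul_bdd (c := (4 * π * s) ^ (-(n : ℝ) / 2))
      (measurable_heatKer_left n s).aestronglyMeasurable
      (Eventually.of_forall fun y => by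
        rw [Real.norm_of_nonneg (heatKer_pos n y hs).le]; exact heatKer_le n y hs)
  have e : ∀ y : Euc n, (gK n 0 (‖y‖ ^ 2) s - gK n 0 1 s) * heatKer n (x - y) t
      = heatKer n (x - y) t * heatKer n y s - gK n 0 1 s * heatKer n (x - y) t := by
    intro y
    rw [heatKer_eq_gK n y s]
    ring
  simp_rw [e]
  rw [integral_sub h1 (hΓ.const_mul _), heatKer_semigroup n x ht hs, integral_const_mul,
    integral_heatKer_sub n x ht, mul_one, heatKer_eq_gK]

theorem exists_genPhi_eq (n : ℕ) (hn : 2 ≤ n) : ∃ c₀ c₁ : ℝ, ∀ (x : Euc n) (t : ℝ), 0 < t →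
    genPhi n x t
      = c₀ + c₁ * ∫ s in Set.Ioi (0 : ℝ), (gK n 0 (‖x‖ ^ 2) (t + s) - gK n 0 1 s) := by
  obtain ⟨c₀, c₁, hc⟩ := exists_lapFund_eq n hn
  refine ⟨c₀, c₁, fun x t ht => ?_⟩
  have hΓ := integrable_heatKer_sub n x ht
  have hP := integrable_genPhi_prod n hn x ht
  have hne : ∀ᵐ y : Euc n, y ≠ 0 := by
    have : Nonempty (Fin n) := ⟨⟨0, by omega⟩⟩
    have : Nontrivial (Euc n) := inferInstance
    exact Measure.ae_ne volume 0
  have e1 : genPhi n x t = ∫ y : Euc n, (c₀ * heatKer n (x - y) t + c₁ *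
      ∫ s in Set.Ioi (0 : ℝ), (gK n 0 (‖y‖ ^ 2) s - gK n 0 1 s) * heatKer n (x - y) t) := by
    refine integral_congr_ae (hne.mono fun y hy => ?_)
    simp only
    rw [hc y hy, integral_mul_const]
    ring
  rw [e1, integral_add (hΓ.const_mul _) (hP.integral_prod_left.const_mul _), integral_const_mul,
    integral_heatKer_sub n x ht, mul_one, integral_const_mul, integral_integral_swap hP]
  congr 2
  exact setIntegral_congr_fun measurableSet_Ioi fun s hs => genPhi_section n x ht hs

theorem integrableOn_genPhi_profile (n : ℕ) (hn : 2 ≤ n) {ρ t : ℝ} (hρ : 0 ≤ ρ) (ht : 0 < t) :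
    IntegrableOn (fun s => gK n 0 ρ (t + s) - gK n 0 1 s) (Set.Ioi 0) := by
  set x : Euc n := EuclideanSpace.single ⟨0, by omega⟩ √ρ
  have hx : ‖x‖ ^ 2 = ρ := by simp [x, Real.sq_sqrt hρ]
  have h := (integrable_genPhi_prod n hn x ht).integral_prod_right
  rw [← hx]
  refine h.congr ((ae_restrict_iff' measurableSet_Ioi).2 (Eventually.of_forall fun s hs => ?_))
  exact genPhi_section n x ht hs

theorem integrableOn_gK_shift (n m : ℕ) (hn : 2 ≤ n) (hm : 1 ≤ m) {ρ t : ℝ} (hρ : -1 ≤ ρ)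
    (ht : 0 < t) : IntegrableOn (fun s => gK n m ρ (t + s)) (Set.Ioi 0) := by
  have hE : ∀ s, 0 ≤ s → |gK n m ρ (t + s)| ≤ Real.exp (1 / (4 * t)) * gK n m 0 (t + s) := by
    intro s hs
    rw [abs_of_nonneg (gK_nonneg _ _ _ (by linarith))]
    refine (gK_le_of_le n m (by linarith) hρ).trans ?_
    have h1 : Real.exp (1 / (4 * (t + s))) ≤ Real.exp (1 / (4 * t)) := by gcongr; linarith
    have h2 := gK_nonneg n m 0 (s := t + s) (by linarith)
    calc gK n m (-1) (t + s) = Real.exp (1 / (4 * (t + s))) * gK n m 0 (t + s) := by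
          simp [gK]; ring
      _ ≤ _ := mul_le_mul_of_nonneg_right h1 h2
  refine integrableOn_Ioi_zero_of_bounds (C := Real.exp (1 / (4 * t)) * gK n m 0 t)
    (C' := Real.exp (1 / (4 * t))) ((measurable_gK_right n m ρ).comp (by fun_prop)) ?_ ?_
  · intro s hs
    refine (hE s hs.1.le).trans ?_
    gcongr
    have hs0 := hs.1
    unfold gK
    have a1 : (4 * π * (t + s)) ^ (-(n : ℝ) / 2) ≤ (4 * π * t) ^ (-(n : ℝ) / 2) := by
      refine Real.rpow_le_rpow_of_nonpos (by positivity) (by gcongr; linarith) ?_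
      have : (0 : ℝ) ≤ n := n.cast_nonneg
      linarith
    have a2 : (2 * (t + s))⁻¹ ≤ (2 * t)⁻¹ := by gcongr; linarith
    have a3 : 0 ≤ (2 * (t + s))⁻¹ := by positivity
    simp only [neg_zero, zero_div, Real.exp_zero, mul_one]
    gcongr
  · intro s hs
    refine (hE s (by linarith)).trans ?_
    gcongr
    refine (gK_le_inv n m hn le_rfl (by linarith)).trans ?_
    have b1 : (t + s)⁻¹ ≤ s⁻¹ := by gcongr; linarith
    have b2 : s⁻¹ ≤ 1 := inv_le_one_of_one_le₀ hs
    have b3 : 0 < (t + s)⁻¹ := inv_pos.2 (by linarith)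
    calc (t + s)⁻¹ ^ (m + 1) ≤ s⁻¹ ^ (m + 1) := by gcongr
      _ ≤ s⁻¹ ^ 2 := pow_le_pow_of_le_one (by positivity) b2 (by omega)

theorem hasDerivAt_integral_gK_shift (n m : ℕ) (hn : 2 ≤ n) {ρ t : ℝ} {h : ℝ → ℝ}
    (hh : Measurable h) (hρ : 0 ≤ ρ) (ht : 0 < t)
    (h_int : IntegrableOn (fun s => gK n m ρ (t + s) - h s) (Set.Ioi 0)) :
    HasDerivAt (fun r => ∫ s in Set.Ioi (0 : ℝ), (gK n m r (t + s) - h s))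
      (-(1 / 2) * ∫ s in Set.Ioi (0 : ℝ), gK n (m + 1) ρ (t + s)) ρ := by
  have hms : ∀ (k : ℕ) (r : ℝ), Measurable (fun s => gK n k r (t + s)) := fun k r =>
    (measurable_gK_right n k r).comp (by fun_prop)
  have hd := hasDerivAt_integral_of_dominated_loc_of_deriv_le
    (F := fun r s => gK n m r (t + s) - h s) (F' := fun r s => -(1 / 2) * gK n (m + 1) r (t + s))
    (bound := fun s => gK n (m + 1) (-1) (t + s)) (μ := volume.restrict (Set.Ioi (0 : ℝ)))
    (Ioi_mem_nhds (show -1 < ρ by linarith))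
    (Eventually.of_forall fun r => ((hms m r).sub hh).aestronglyMeasurable)
    h_int ((hms (m + 1) ρ).const_mul _).aestronglyMeasurable ?_
    (integrableOn_gK_shift n (m + 1) hn (by omega) le_rfl ht) ?_
  · exact hd.2.congr_deriv (integral_const_mul _ _)
  · refine (ae_restrict_iff' measurableSet_Ioi).2 (Eventually.of_forall fun s hs r hr => ?_)
    have hs0 : 0 < t + s := add_pos ht hs
    have h1 := gK_nonneg n (m + 1) r hs0
    have h2 := gK_le_of_le n (m + 1) hs0 (le_of_lt hr)
    rw [Real.norm_eq_abs, abs_le]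
    constructor <;> linarith
  · refine Eventually.of_forall fun s r hr => ?_
    simpa using (hasDerivAt_gK n m r (t + s)).sub_const (h s)

/-- The third spatial derivatives of the heat kernel. -/
def heatD3 (n : ℕ) (i j k : Fin n) (x : Euc n) (s : ℝ) : ℝ :=
  radD3 n (fun m ρ => gK n m ρ s) i j k x

theorem exists_Kten_eq (n : ℕ) (hn : 2 ≤ n) : ∃ c : ℝ, ∀ (i j k : Fin n) (x : Euc n) (t : ℝ),
    0 < t → Kten n i j k x t = c * ∫ s in Set.Ioi (0 : ℝ),
      ((if i = j then -∑ m, heatD3 n m m k x (t + s) else 0) + heatD3 n i j k x (t + s)) := by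
  obtain ⟨c₀, c₁, hc⟩ := exists_genPhi_eq n hn
  refine ⟨c₁, fun i j k x t ht => ?_⟩
  let f : ℕ → ℝ → ℝ := fun m ρ => match m with
    | 0 => c₀ + c₁ * ∫ s in Set.Ioi (0 : ℝ), (gK n 0 ρ (t + s) - gK n 0 1 s)
    | m + 1 => c₁ * ∫ s in Set.Ioi (0 : ℝ), (gK n (m + 1) ρ (t + s) - 0)
  have hf : ∀ m, ∀ ρ, 0 ≤ ρ → HasDerivAt (f m) (-(1 / 2) * f (m + 1) ρ) ρ := by
    intro m ρ hρ
    cases m with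
    | zero =>
      refine (((hasDerivAt_integral_gK_shift n 0 hn (measurable_gK_right n 0 1) hρ ht
        (integrableOn_genPhi_profile n hn hρ ht)).const_mul c₁).const_add c₀).congr_deriv ?_
      simp only [f, sub_zero]
      ring
    | succ m =>
      refine ((hasDerivAt_integral_gK_shift n (m + 1) hn (h := fun _ => 0) measurable_const hρ ht
        ?_).const_mul c₁).congr_deriv ?_
      · simpa using integrableOn_gK_shift n (m + 1) hn (by omega) (by linarith) ht
      · simp only [f, sub_zero]
        ring
  have hi : ∀ m, 1 ≤ m → IntegrableOn (fun s => gK n m (‖x‖ ^ 2) (t + s)) (Set.Ioi 0) := fun m hm =>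
    integrableOn_gK_shift n m hn hm (by nlinarith [sq_nonneg ‖x‖]) ht
  have hiD : ∀ a b d : Fin n, IntegrableOn (fun s => heatD3 n a b d x (t + s)) (Set.Ioi 0) :=
    fun a b d => ((hi 2 (by norm_num)).const_mul _).sub ((hi 3 (by norm_num)).const_mul _)
  have hD : ∀ a b d : Fin n, radD3 n f a b d x
      = c₁ * ∫ s in Set.Ioi (0 : ℝ), heatD3 n a b d x (t + s) := by
    intro a b d
    simp only [heatD3, radD3, f, sub_zero]
    rw [integral_sub ((hi 2 (by norm_num)).const_mul _) ((hi 3 (by norm_num)).const_mul _),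
      integral_const_mul, integral_const_mul]
    ring
  rw [Kten_of_radial n hf (fun y => hc y t ht)]
  simp_rw [hD]
  by_cases hij : i = j
  · simp only [hij, if_true]
    have hN : IntegrableOn (fun s => -∑ m, heatD3 n m m k x (t + s)) (Set.Ioi 0) :=
      (integrable_finsetSum _ fun m _ => hiD m m k).neg
    rw [integral_add hN (hiD j j k), integral_neg,
      integral_finsetSum _ fun m _ => hiD m m k, ← Finset.mul_sum]
    ring
  · simp [hij]

theorem gK_eq_heatKer (n m : ℕ) (x : Euc n) (s : ℝ) :
    gK n m (‖x‖ ^ 2) s = (2 * s)⁻¹ ^ m * heatKer n x s := by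
  simp only [heatKer, gK]; ring

theorem abs_coord_le (n : ℕ) (x : Euc n) (i : Fin n) : |x i| ≤ ‖x‖ := PiLp.norm_apply_le x i

theorem abs_heatD3_le (n : ℕ) (i j k : Fin n) (x : Euc n) {s : ℝ} (hs : 0 < s) :
    |heatD3 n i j k x s|
      ≤ 3 * ‖x‖ * gK n 2 (‖x‖ ^ 2) s + ‖x‖ ^ 3 * gK n 3 (‖x‖ ^ 2) s := by
  have hi := abs_coord_le n x i
  have hj := abs_coord_le n x j
  have hk := abs_coord_le n x k
  have h0 := norm_nonneg x
  have g2 := gK_nonneg n 2 (‖x‖ ^ 2) hs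
  have g3 := gK_nonneg n 3 (‖x‖ ^ 2) hs
  have e1 : |(if i = j then x k else 0) + (if i = k then x j else 0) + (if j = k then x i else 0)|
      ≤ 3 * ‖x‖ := by
    have a1 : |if i = j then x k else 0| ≤ ‖x‖ := by split_ifs <;> simp [hk]
    have a2 : |if i = k then x j else 0| ≤ ‖x‖ := by split_ifs <;> simp [hj]
    have a3 : |if j = k then x i else 0| ≤ ‖x‖ := by split_ifs <;> simp [hi]
    refine (abs_add_three _ _ _).trans ?_
    linarith
  have e2 : |x i * x j * x k| ≤ ‖x‖ ^ 3 := by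
    rw [abs_mul, abs_mul]
    calc _ ≤ ‖x‖ * ‖x‖ * ‖x‖ := by gcongr
      _ = _ := by ring
  simp only [heatD3, radD3]
  refine (abs_sub _ _).trans ?_
  rw [abs_mul, abs_mul, abs_of_nonneg g2, abs_of_nonneg g3]
  gcongr

theorem exists_abs_heatD3_le (n : ℕ) : ∃ C, 0 ≤ C ∧ ∀ (i j k : Fin n) (x : Euc n) (s : ℝ), 0 < s →
    |heatD3 n i j k x s| ≤ C * (√s)⁻¹ ^ 3 * heatKer n x (2 * s) := by
  set A := fun m : ℕ => (2 : ℝ) ^ ((n : ℝ) / 2) * (m.factorial * Real.exp 8)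
  have hA : ∀ m, 0 ≤ A m := fun m => by positivity
  refine ⟨3 * A 1 + A 3, by have := hA 1; have := hA 3; positivity, fun i j k x s hs => ?_⟩
  have hst : 0 < √s := Real.sqrt_pos.2 hs
  have h1 := norm_pow_mul_heatKer_le n 1 x hs
  have h3 := norm_pow_mul_heatKer_le n 3 x hs
  have hh := (heatKer_pos n x (t := 2 * s) (by positivity)).le
  have hs' : (2 * s)⁻¹ ≤ (√s)⁻¹ ^ 2 := by
    rw [inv_pow, Real.sq_sqrt hs.le]; gcongr; linarith
  have hs0 : 0 ≤ (2 * s)⁻¹ := by positivity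
  have e2 : 3 * ‖x‖ * gK n 2 (‖x‖ ^ 2) s ≤ 3 * A 1 * (√s)⁻¹ ^ 3 * heatKer n x (2 * s) := by
    rw [gK_eq_heatKer]
    calc _ = 3 * ((2 * s)⁻¹ ^ 2 * (‖x‖ ^ 1 * heatKer n x s)) := by ring
      _ ≤ 3 * (((√s)⁻¹ ^ 2) ^ 2 * (A 1 * √s ^ 1 * heatKer n x (2 * s))) := by
          have := heatKer_pos n x hs
          gcongr
      _ = _ := by field_simp
  have e3 : ‖x‖ ^ 3 * gK n 3 (‖x‖ ^ 2) s ≤ A 3 * (√s)⁻¹ ^ 3 * heatKer n x (2 * s) := by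
    rw [gK_eq_heatKer]
    calc _ = (2 * s)⁻¹ ^ 3 * (‖x‖ ^ 3 * heatKer n x s) := by ring
      _ ≤ ((√s)⁻¹ ^ 2) ^ 3 * (A 3 * √s ^ 3 * heatKer n x (2 * s)) := by
          have := heatKer_pos n x hs
          gcongr
      _ = _ := by field_simp
  calc _ ≤ _ := abs_heatD3_le n i j k x hs
    _ ≤ 3 * A 1 * (√s)⁻¹ ^ 3 * heatKer n x (2 * s) + A 3 * (√s)⁻¹ ^ 3 * heatKer n x (2 * s) :=
        add_le_add e2 e3
    _ = _ := by ring

theorem measurable_coord (n : ℕ) (i : Fin n) : Measurable (fun x : Euc n => x i) :=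
  (EuclideanSpace.proj (𝕜 := ℝ) i : Euc n →L[ℝ] ℝ).measurable

theorem measurable_gK_norm (n m : ℕ) :
    Measurable (fun q : Euc n × ℝ => gK n m (‖q.1‖ ^ 2) q.2) :=
  (measurable_gK n m).comp ((measurable_fst.norm.pow_const 2).prodMk measurable_snd)

theorem measurable_heatD3 (n : ℕ) (i j k : Fin n) :
    Measurable (fun q : Euc n × ℝ => heatD3 n i j k q.1 q.2) := by
  have hc : ∀ a, Measurable (fun q : Euc n × ℝ => q.1 a) := fun a =>
    (measurable_coord n a).comp measurable_fst
  have hite : ∀ (p : Prop) [Decidable p] (a : Fin n),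
      Measurable (fun q : Euc n × ℝ => if p then q.1 a else 0) := by
    intro p _ a
    split_ifs
    exacts [hc a, measurable_const]
  unfold heatD3 radD3
  exact ((((hite _ k).add (hite _ j)).add (hite _ i)).mul (measurable_gK_norm n 2)).sub
    ((((hc i).mul (hc j)).mul (hc k)).mul (measurable_gK_norm n 3))

theorem heat_conv_deriv (n : ℕ) {a : ℝ} (ha : 0 < a) (e : Euc n) {g g' G G' : Euc n → ℝ}
    (hg : ∀ x, ∃ L : Euc n →L[ℝ] ℝ, HasFDerivAt g L x ∧ L e = g' x)
    (hG : ∀ x, ∃ L : Euc n →L[ℝ] ℝ, HasFDerivAt G L x ∧ L e = G' x)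
    (hgb : ∃ C, ∀ x, |g x| ≤ C) (hgb' : ∃ C, ∀ x, |g' x| ≤ C) (hgm' : Measurable g')
    (hconv : ∀ x, ∫ y, heatKer n (x - y) a * g y = G x) (x : Euc n) :
    ∫ y, heatKer n (x - y) a * g' y = G' x := by
  obtain ⟨C, hC⟩ := hgb
  obtain ⟨C', hC'⟩ := hgb'
  have hgm : Measurable g :=
    (continuous_iff_continuousAt.2 fun x => (hg x).choose_spec.1.continuousAt).measurable
  have hswap : ∀ (h : Euc n → ℝ) (x : Euc n),
      ∫ y, heatKer n (x - y) a * h y = ∫ z, heatKer n z a * h (x - z) := by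
    intro h x
    rw [← integral_sub_left_eq_self (fun z => heatKer n z a * h (x - z)) volume x]
    simp
  have hline : ∀ (h h' : Euc n → ℝ),
      (∀ x, ∃ L : Euc n →L[ℝ] ℝ, HasFDerivAt h L x ∧ L e = h' x) → ∀ (z : Euc n) (r : ℝ),
      HasDerivAt (fun r : ℝ => h (x + r • e - z)) (h' (x + r • e - z)) r := by
    intro h h' hh z r
    obtain ⟨L, hL, hLe⟩ := hh (x + r • e - z)
    have h1 : HasDerivAt (fun r : ℝ => x + r • e - z) e r := by
      simpa using (((hasDerivAt_id r).smul_const e).const_add x).sub_const z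
    rw [← hLe]
    exact hL.comp_hasDerivAt r h1
  have hΓ := integrable_heatKer n ha
  have hd := hasDerivAt_integral_of_dominated_loc_of_deriv_le (μ := (volume : Measure (Euc n)))
    (F := fun (r : ℝ) z => heatKer n z a * g (x + r • e - z))
    (F' := fun (r : ℝ) z => heatKer n z a * g' (x + r • e - z))
    (bound := fun z => heatKer n z a * C') (x₀ := (0 : ℝ)) Filter.univ_mem
    (Eventually.of_forall fun r => ((measurable_heatKer_left n a).mul
      (hgm.comp (measurable_const_sub _))).aestronglyMeasurable)
    (hΓ.mul_bdd (c := C) (hgm.comp (measurable_const_sub _)).aestronglyMeasurable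
      (Eventually.of_forall fun z => hC _))
    ((measurable_heatKer_left n a).mul (hgm'.comp (measurable_const_sub _))).aestronglyMeasurable
    (Eventually.of_forall fun z r _ => by
      rw [norm_mul, Real.norm_of_nonneg (heatKer_pos n z ha).le]
      exact mul_le_mul_of_nonneg_left (hC' _) (heatKer_pos n z ha).le)
    (hΓ.mul_const _)
    (Eventually.of_forall fun z r _ => (hline g g' hg z r).const_mul _)
  have hd2 := hline G G' hG 0 0
  have heq : (fun r : ℝ => ∫ z, heatKer n z a * g (x + r • e - z))
      = fun r : ℝ => G (x + r • e - 0) := by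
    funext r
    rw [← hswap, hconv, sub_zero]
  have h3 := hd.2
  rw [heq] at h3
  have h4 := h3.unique hd2
  rw [hswap]
  simpa using h4

theorem exists_norm_pow_mul_gK_le (n m p : ℕ) {s : ℝ} (hs : 0 < s) :
    ∃ C, ∀ x : Euc n, ‖x‖ ^ m * gK n p (‖x‖ ^ 2) s ≤ C := by
  refine ⟨(2 * s)⁻¹ ^ p * ((2 : ℝ) ^ ((n : ℝ) / 2) * (m.factorial * Real.exp 8) * √s ^ m
    * (4 * π * (2 * s)) ^ (-(n : ℝ) / 2)), fun x => ?_⟩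
  have h1 := norm_pow_mul_heatKer_le n m x hs
  have h2 := heatKer_le n x (t := 2 * s) (by positivity)
  rw [gK_eq_heatKer, mul_left_comm]
  refine mul_le_mul_of_nonneg_left (h1.trans ?_) (by positivity)
  gcongr

theorem heatD3_semigroup (n : ℕ) (i j k : Fin n) (x : Euc n) {a s : ℝ} (ha : 0 < a) (hs : 0 < s) :
    ∫ y : Euc n, heatKer n (x - y) a * heatD3 n i j k y s = heatD3 n i j k x (a + s) := by
  have hf : ∀ s : ℝ, ∀ m, ∀ ρ, 0 ≤ ρ → HasDerivAt ((fun (m : ℕ) ρ => gK n m ρ s) m)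
      (-(1 / 2) * (fun (m : ℕ) ρ => gK n m ρ s) (m + 1) ρ) ρ := fun s m ρ _ => hasDerivAt_gK n m ρ s
  have hg : ∀ m, Measurable (fun x : Euc n => gK n m (‖x‖ ^ 2) s) := fun m =>
    (measurable_gK_norm n m).comp (measurable_id.prodMk measurable_const)
  have b0 : ∃ C, ∀ x : Euc n, |gK n 0 (‖x‖ ^ 2) s| ≤ C := by
    obtain ⟨C, hC⟩ := exists_norm_pow_mul_gK_le n 0 0 hs
    refine ⟨C, fun x => ?_⟩
    rw [abs_of_nonneg (gK_nonneg _ _ _ hs)]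
    simpa using hC x
  have b1 : ∀ j, ∃ C, ∀ x : Euc n, |radD1 n (fun m ρ => gK n m ρ s) j x| ≤ C := by
    intro j
    obtain ⟨C, hC⟩ := exists_norm_pow_mul_gK_le n 1 1 hs
    refine ⟨C, fun x => ?_⟩
    have h0 := gK_nonneg n 1 (‖x‖ ^ 2) hs
    rw [radD1, abs_neg, abs_mul, abs_of_nonneg h0]
    refine le_trans ?_ (hC x)
    rw [pow_one]
    exact mul_le_mul_of_nonneg_right (abs_coord_le n x j) h0
  have b2 : ∀ i j, ∃ C, ∀ x : Euc n, |radD2 n (fun m ρ => gK n m ρ s) i j x| ≤ C := by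
    intro i j
    obtain ⟨C, hC⟩ := exists_norm_pow_mul_gK_le n 0 1 hs
    obtain ⟨C', hC'⟩ := exists_norm_pow_mul_gK_le n 2 2 hs
    refine ⟨C + C', fun x => ?_⟩
    have h0 := gK_nonneg n 1 (‖x‖ ^ 2) hs
    have h1 := gK_nonneg n 2 (‖x‖ ^ 2) hs
    refine (abs_add_le _ _).trans (add_le_add (le_trans ?_ (hC x)) (le_trans ?_ (hC' x)))
    · split_ifs
      · simp [abs_of_nonneg h0]
      · simpa using h0
    · rw [abs_mul, abs_of_nonneg h1, abs_mul]
      refine mul_le_mul_of_nonneg_right ?_ h1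
      rw [sq]
      exact mul_le_mul (abs_coord_le n x i) (abs_coord_le n x j) (abs_nonneg _)
        (norm_nonneg _)
  have b3 : ∃ C, ∀ x : Euc n, |heatD3 n i j k x s| ≤ C := by
    obtain ⟨C, hC⟩ := exists_norm_pow_mul_gK_le n 1 2 hs
    obtain ⟨C', hC'⟩ := exists_norm_pow_mul_gK_le n 3 3 hs
    refine ⟨3 * C + C', fun x => ?_⟩
    have h1 := hC x
    rw [pow_one] at h1
    refine (abs_heatD3_le n i j k x hs).trans (add_le_add ?_ (hC' x))
    linarith
  have m1 : Measurable (radD1 n (fun m ρ => gK n m ρ s) j) :=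
    ((measurable_coord n j).mul (hg 1)).neg
  have m2 : Measurable (radD2 n (fun m ρ => gK n m ρ s) i j) :=
    (continuous_iff_continuousAt.2 fun x =>
      (exists_hasFDerivAt_radD2 n (hf s) i j x).choose_spec.1.continuousAt).measurable
  have m3 : Measurable (fun x => heatD3 n i j k x s) :=
    (measurable_heatD3 n i j k).comp (measurable_id.prodMk measurable_const)
  have s0 : ∀ x : Euc n, ∫ y : Euc n, heatKer n (x - y) a * gK n 0 (‖y‖ ^ 2) s
      = gK n 0 (‖x‖ ^ 2) (a + s) := by
    intro x
    simp_rw [← heatKer_eq_gK]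
    exact heatKer_semigroup n x ha hs
  have s1 := heat_conv_deriv n ha (EuclideanSpace.single j 1)
    (fun x => (exists_hasFDerivAt_rad0 n (hf s) x).imp fun L h => ⟨h.1, h.2 j⟩)
    (fun x => (exists_hasFDerivAt_rad0 n (hf (a + s)) x).imp fun L h => ⟨h.1, h.2 j⟩)
    b0 (b1 j) m1 s0
  have s2 := heat_conv_deriv n ha (EuclideanSpace.single i 1)
    (fun x => (exists_hasFDerivAt_radD1 n (hf s) j x).imp fun L h => ⟨h.1, h.2 i⟩)
    (fun x => (exists_hasFDerivAt_radD1 n (hf (a + s)) j x).imp fun L h => ⟨h.1, h.2 i⟩)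
    (b1 j) (b2 i j) m2 s1
  exact heat_conv_deriv n ha (EuclideanSpace.single k 1)
    (fun x => (exists_hasFDerivAt_radD2 n (hf s) i j x).imp fun L h => ⟨h.1, h.2 k⟩)
    (fun x => (exists_hasFDerivAt_radD2 n (hf (a + s)) i j x).imp fun L h => ⟨h.1, h.2 k⟩)
    (b2 i j) b3 m3 s2 x

theorem gK_scaling (n m : ℕ) (ρ : ℝ) {lam s : ℝ} (hl : 0 < lam) (hs : 0 < s) :
    gK n m (lam ^ 2 * ρ) (lam ^ 2 * s) = lam⁻¹ ^ n * (lam⁻¹ ^ 2) ^ m * gK n m ρ s := by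
  unfold gK
  have e1 : (4 * π * (lam ^ 2 * s)) ^ (-(n : ℝ) / 2)
      = lam⁻¹ ^ n * (4 * π * s) ^ (-(n : ℝ) / 2) := by
    rw [show 4 * π * (lam ^ 2 * s) = lam ^ 2 * (4 * π * s) by ring,
      Real.mul_rpow (by positivity) (by positivity)]
    congr 1
    rw [← Real.rpow_natCast lam 2, ← Real.rpow_mul hl.le, ← Real.rpow_natCast lam⁻¹ n,
      Real.inv_rpow hl.le, ← Real.rpow_neg hl.le]
    congr 1
    push_cast
    ring
  have e2 : -(lam ^ 2 * ρ) / (4 * (lam ^ 2 * s)) = -ρ / (4 * s) := by field_simp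
  have e3 : (2 * (lam ^ 2 * s))⁻¹ = lam⁻¹ ^ 2 * (2 * s)⁻¹ := by field_simp
  rw [e1, e2, e3, mul_pow]
  ring

theorem heatKer_scaling (n : ℕ) (x : Euc n) {lam s : ℝ} (hl : 0 < lam) (hs : 0 < s) :
    heatKer n (lam • x) (lam ^ 2 * s) = lam⁻¹ ^ n * heatKer n x s := by
  rw [heatKer_eq_gK, heatKer_eq_gK, norm_smul, mul_pow, Real.norm_eq_abs, sq_abs,
    gK_scaling n 0 _ hl hs]
  simp

theorem heatD3_scaling (n : ℕ) (i j k : Fin n) (x : Euc n) {lam s : ℝ} (hl : 0 < lam)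
    (hs : 0 < s) :
    heatD3 n i j k (lam • x) (lam ^ 2 * s) = lam⁻¹ ^ (n + 3) * heatD3 n i j k x s := by
  simp only [heatD3, radD3]
  rw [norm_smul, mul_pow, Real.norm_eq_abs, sq_abs, gK_scaling n 2 _ hl hs,
    gK_scaling n 3 _ hl hs]
  simp only [PiLp.smul_apply, smul_eq_mul]
  have e : ∀ (p : Prop) [Decidable p] (r : ℝ),
      (if p then lam * r else 0) = lam * (if p then r else 0) := by
    intro p _ r
    split_ifs <;> simp
  simp only [e]
  rw [pow_add]
  field_simp

/-- The density whose time integral is, up to a constant, the kernel `Kten`. -/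
def oseenD (n : ℕ) (i j k : Fin n) (x : Euc n) (s : ℝ) : ℝ :=
  (if i = j then -∑ m, heatD3 n m m k x s else 0) + heatD3 n i j k x s

theorem measurable_oseenD (n : ℕ) (i j k : Fin n) :
    Measurable (fun q : Euc n × ℝ => oseenD n i j k q.1 q.2) := by
  unfold oseenD
  refine Measurable.add ?_ (measurable_heatD3 n i j k)
  split_ifs
  · exact (Finset.measurable_sum _ fun m _ => measurable_heatD3 n m m k).neg
  · exact measurable_const

theorem exists_abs_oseenD_le (n : ℕ) : ∃ C, 0 ≤ C ∧ ∀ (i j k : Fin n) (x : Euc n) (s : ℝ), 0 < s →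
    |oseenD n i j k x s| ≤ C * (√s)⁻¹ ^ 3 * heatKer n x (2 * s) := by
  obtain ⟨C, hC0, hC⟩ := exists_abs_heatD3_le n
  refine ⟨n * C + C, by positivity, fun i j k x s hs => ?_⟩
  have hp := (heatKer_pos n x (show 0 < 2 * s by positivity)).le
  have h : |∑ m, heatD3 n m m k x s| ≤ n * (C * (√s)⁻¹ ^ 3 * heatKer n x (2 * s)) := by
    refine (Finset.abs_sum_le_sum_abs _ _).trans
      ((Finset.sum_le_sum fun m _ => hC m m k x s hs).trans ?_)
    simp
  rw [oseenD, add_mul, add_mul]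
  refine (abs_add_le _ _).trans (add_le_add ?_ (hC i j k x s hs))
  rw [mul_assoc, mul_assoc, ← mul_assoc C]
  split_ifs
  · rwa [abs_neg]
  · rw [abs_zero]; positivity

theorem integrable_heatD3 (n : ℕ) (i j k : Fin n) {s : ℝ} (hs : 0 < s) :
    Integrable (fun x => heatD3 n i j k x s) := by
  obtain ⟨C, hC0, hC⟩ := exists_abs_heatD3_le n
  exact ((integrable_heatKer n (show 0 < 2 * s by positivity)).const_mul _).mono'
    ((measurable_heatD3 n i j k).comp (measurable_id.prodMk measurable_const)).aestronglyMeasurable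
    (.of_forall fun x => hC i j k x s hs)

theorem integrable_oseenD (n : ℕ) (i j k : Fin n) {s : ℝ} (hs : 0 < s) :
    Integrable (fun x => oseenD n i j k x s) := by
  unfold oseenD
  refine Integrable.add ?_ (integrable_heatD3 n i j k hs)
  split_ifs
  · exact (integrable_finsetSum _ fun m _ => integrable_heatD3 n m m k hs).neg
  · exact integrable_zero _ _ _

theorem Integrable.heatKer_mul {n : ℕ} {f : Euc n → ℝ} (hf : Integrable f) (x : Euc n) {a : ℝ}
    (ha : 0 < a) : Integrable (fun y => heatKer n (x - y) a * f y) := by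
  refine hf.bdd_mul (c := (4 * π * a) ^ (-(n : ℝ) / 2))
    ((measurable_heatKer_left n a).comp (measurable_const.sub measurable_id)).aestronglyMeasurable
    (.of_forall fun y => ?_)
  rw [Real.norm_eq_abs, abs_of_pos (heatKer_pos n _ ha)]
  exact heatKer_le n _ ha

theorem oseenD_semigroup (n : ℕ) (i j k : Fin n) (x : Euc n) {a s : ℝ} (ha : 0 < a) (hs : 0 < s) :
    ∫ y : Euc n, heatKer n (x - y) a * oseenD n i j k y s = oseenD n i j k x (a + s) := by
  unfold oseenD
  have h1 := fun i j k => Integrable.heatKer_mul (integrable_heatD3 n i j k hs) x ha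
  split_ifs
  · simp_rw [mul_add, mul_neg, Finset.mul_sum]
    have h2 : Integrable fun y => ∑ m, heatKer n (x - y) a * heatD3 n m m k y s :=
      integrable_finsetSum _ fun m _ => h1 m m k
    rw [integral_add h2.fun_neg (h1 i j k), integral_neg,
      integral_finsetSum _ fun m _ => h1 m m k, heatD3_semigroup n i j k x ha hs]
    simp_rw [heatD3_semigroup n _ _ k x ha hs]
  · simp_rw [zero_add]
    exact heatD3_semigroup n i j k x ha hs

theorem oseenD_scaling (n : ℕ) (i j k : Fin n) (x : Euc n) {lam s : ℝ} (hl : 0 < lam)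
    (hs : 0 < s) :
    oseenD n i j k (lam • x) (lam ^ 2 * s) = lam⁻¹ ^ (n + 3) * oseenD n i j k x s := by
  unfold oseenD
  simp_rw [heatD3_scaling n _ _ _ x hl hs]
  split_ifs
  · rw [mul_add, mul_neg, Finset.mul_sum]
  · simp

theorem integral_Ioi_zero_add_rpow {t : ℝ} (ht : 0 < t) :
    ∫ s in Set.Ioi (0 : ℝ), (s + t) ^ (-(3 / 2) : ℝ) = 2 * t ^ (-(1 / 2) : ℝ) := by
  have h1 := integral_Ioi_rpow_of_lt (a := -(3 / 2)) (by norm_num) ht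
  have h2 := (measurePreserving_add_right volume t).setIntegral_preimage_emb
    (MeasurableEquiv.addRight t).measurableEmbedding (fun s : ℝ => s ^ (-(3 / 2) : ℝ)) (Set.Ioi t)
  rw [Set.preimage_add_const_Ioi, sub_self] at h2
  rw [h2, h1]
  norm_num
  ring

theorem integrable_prod_of_section_le {E : Type*} [MeasurableSpace E] {μ : Measure E} [SFinite μ]
    {f : E × ℝ → ℝ} {g : ℝ → ℝ} {S : Set ℝ} (hS : MeasurableSet S) (hf : Measurable f)
    (hs : ∀ s ∈ S, Integrable (fun x => f (x, s)) μ) (hg : IntegrableOn g S)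
    (hb : ∀ s ∈ S, ∫ x, |f (x, s)| ∂μ ≤ g s) :
    Integrable f (μ.prod (volume.restrict S)) ∧
      ∫ q, |f q| ∂(μ.prod (volume.restrict S)) ≤ ∫ s in S, g s := by
  have hm' : StronglyMeasurable (fun s : ℝ => ∫ x, |f (x, s)| ∂μ) :=
    hf.norm.stronglyMeasurable.integral_prod_left'
  have h_int : Integrable f (μ.prod (volume.restrict S)) := by
    rw [integrable_prod_iff' hf.aestronglyMeasurable]
    refine ⟨(ae_restrict_mem hS).mono hs, ?_⟩
    refine hg.mono' hm'.aestronglyMeasurable ((ae_restrict_mem hS).mono fun s hs => ?_)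
    rw [Real.norm_eq_abs, abs_of_nonneg (integral_nonneg fun _ => norm_nonneg _)]
    exact hb s hs
  refine ⟨h_int, ?_⟩
  rw [integral_prod_symm _ h_int.abs]
  exact setIntegral_mono_on h_int.abs.integral_prod_right hg hS hb

theorem exists_integral_abs_oseenD_le (n : ℕ) : ∃ C, 0 ≤ C ∧ ∀ (i j k : Fin n) (s : ℝ), 0 < s →
    ∫ x, |oseenD n i j k x s| ≤ C * s ^ (-(3 / 2) : ℝ) := by
  obtain ⟨C, hC0, hC⟩ := exists_abs_oseenD_le n
  refine ⟨C, hC0, fun i j k s hs => ?_⟩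
  have h2 : 0 < 2 * s := by positivity
  refine (integral_mono (integrable_oseenD n i j k hs).abs
    ((integrable_heatKer n h2).const_mul _) fun x => hC i j k x _ hs).trans (le_of_eq ?_)
  rw [integral_const_mul, integral_heatKer n h2, mul_one]
  congr 1
  rw [Real.sqrt_eq_rpow, ← Real.rpow_neg hs.le, ← Real.rpow_natCast, ← Real.rpow_mul hs.le]
  norm_num

theorem measurable_oseenD_shift (n : ℕ) (i j k : Fin n) (t : ℝ) :
    Measurable (fun q : Euc n × ℝ => oseenD n i j k q.1 (t + q.2)) :=
  Measurable.comp (g := fun q : Euc n × ℝ => oseenD n i j k q.1 q.2)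
    (f := fun q : Euc n × ℝ => (q.1, t + q.2)) (measurable_oseenD n i j k)
    (measurable_fst.prodMk (measurable_snd.const_add t))

theorem exists_oseen_integrable (n : ℕ) : ∃ C, 0 ≤ C ∧ ∀ (i j k : Fin n) (t : ℝ), 0 < t →
    Integrable (fun q : Euc n × ℝ => oseenD n i j k q.1 (t + q.2))
      (volume.prod (volume.restrict (Set.Ioi 0))) ∧
    ∫ q : Euc n × ℝ, |oseenD n i j k q.1 (t + q.2)| ∂(volume.prod (volume.restrict (Set.Ioi 0)))
      ≤ C * t ^ (-(1 / 2) : ℝ) := by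
  obtain ⟨C, hC0, hC⟩ := exists_integral_abs_oseenD_le n
  refine ⟨C * 2, by positivity, fun i j k t ht => ?_⟩
  have hI : IntegrableOn (fun s : ℝ => C * (s + t) ^ (-(3 / 2) : ℝ)) (Set.Ioi 0) :=
    (integrableOn_add_rpow_Ioi_of_lt (by norm_num) (by linarith)).const_mul C
  have hm : Measurable (fun q : Euc n × ℝ => oseenD n i j k q.1 (t + q.2)) :=
    measurable_oseenD_shift n i j k t
  have h1 : ∀ s ∈ Set.Ioi (0 : ℝ), Integrable (fun x => oseenD n i j k x (t + s)) :=
    fun s hs => integrable_oseenD n i j k (add_pos ht hs)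
  have h2 : ∀ s ∈ Set.Ioi (0 : ℝ), ∫ x, |oseenD n i j k x (t + s)|
      ≤ C * (s + t) ^ (-(3 / 2) : ℝ) := by
    intro s hs
    rw [add_comm s]
    exact hC i j k _ (add_pos ht hs)
  have h := integrable_prod_of_section_le (μ := volume) measurableSet_Ioi hm h1 hI h2
  refine ⟨h.1, h.2.trans (le_of_eq ?_)⟩
  rw [integral_const_mul, integral_Ioi_zero_add_rpow ht, mul_assoc]

theorem exists_Kten_eq_integral_oseenD (n : ℕ) (hn : 2 ≤ n) : ∃ c : ℝ,
    ∀ (i j k : Fin n) (x : Euc n) (t : ℝ), 0 < t →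
      Kten n i j k x t = c * ∫ s in Set.Ioi 0, oseenD n i j k x (t + s) :=
  exists_Kten_eq n hn

theorem measurable_Kten_pos (n : ℕ) (hn : 2 ≤ n) (i j k : Fin n) :
    Measurable (fun q : Euc n × ℝ => if 0 < q.2 then Kten n i j k q.1 q.2 else 0) := by
  obtain ⟨c, hc⟩ := exists_Kten_eq_integral_oseenD n hn
  have h1 : Measurable (fun p : (Euc n × ℝ) × ℝ => oseenD n i j k p.1.1 (p.1.2 + p.2)) :=
    Measurable.comp (g := fun q : Euc n × ℝ => oseenD n i j k q.1 q.2)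
      (f := fun p : (Euc n × ℝ) × ℝ => (p.1.1, p.1.2 + p.2)) (measurable_oseenD n i j k)
      (measurable_fst.fst.prodMk (measurable_fst.snd.add measurable_snd))
  have h2 : StronglyMeasurable (fun q : Euc n × ℝ =>
      ∫ s in Set.Ioi (0 : ℝ), oseenD n i j k q.1 (q.2 + s)) :=
    h1.stronglyMeasurable.integral_prod_right'
  have h3 : (fun q : Euc n × ℝ => if 0 < q.2 then Kten n i j k q.1 q.2 else 0)
      = fun q => if 0 < q.2 then c * ∫ s in Set.Ioi (0 : ℝ), oseenD n i j k q.1 (q.2 + s)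
        else 0 := by
    funext q
    split_ifs with h
    · exact hc i j k q.1 q.2 h
    · rfl
  rw [h3]
  exact Measurable.ite (measurableSet_lt measurable_const measurable_snd)
    (h2.measurable.const_mul c) measurable_const

theorem exists_Kten_integrable (n : ℕ) (hn : 2 ≤ n) : ∃ C, 0 ≤ C ∧
    ∀ (i j k : Fin n) (t : ℝ), 0 < t → Integrable (fun x => Kten n i j k x t) ∧
      ∫ x, |Kten n i j k x t| ≤ C * t ^ (-(1 / 2) : ℝ) := by
  obtain ⟨c, hc⟩ := exists_Kten_eq_integral_oseenD n hn
  obtain ⟨C, hC0, hC⟩ := exists_oseen_integrable n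
  refine ⟨|c| * C, by positivity, fun i j k t ht => ?_⟩
  obtain ⟨hI, hB⟩ := hC i j k t ht
  simp_rw [hc i j k _ t ht]
  refine ⟨hI.integral_prod_left.const_mul c, ?_⟩
  simp_rw [abs_mul]
  rw [integral_const_mul, mul_assoc]
  refine mul_le_mul_of_nonneg_left (le_trans ?_ hB) (abs_nonneg c)
  rw [integral_prod _ hI.abs]
  exact integral_mono hI.integral_prod_left.abs hI.abs.integral_prod_left
    fun x => abs_integral_le_integral_abs

theorem integral_heatKer_mul_Kten (n : ℕ) (hn : 2 ≤ n) (i j k : Fin n) (x : Euc n) {a t : ℝ}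
    (ha : 0 < a) (ht : 0 < t) :
    ∫ y : Euc n, heatKer n (x - y) a * Kten n i j k y t = Kten n i j k x (a + t) := by
  obtain ⟨c, hc⟩ := exists_Kten_eq_integral_oseenD n hn
  obtain ⟨C, hC0, hC⟩ := exists_oseen_integrable n
  obtain ⟨hI, -⟩ := hC i j k t ht
  simp_rw [hc i j k _ t ht, hc i j k _ (a + t) (add_pos ha ht), mul_left_comm _ c,
    ← integral_const_mul (heatKer n _ a)]
  rw [integral_const_mul]
  congr 1
  have hI' : Integrable (Function.uncurry fun (y : Euc n) (s : ℝ) =>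
      heatKer n (x - y) a * oseenD n i j k y (t + s))
      ((volume : Measure (Euc n)).prod (volume.restrict (Set.Ioi (0 : ℝ)))) := by
    refine hI.bdd_mul (c := (4 * π * a) ^ (-(n : ℝ) / 2))
      ((measurable_heatKer_left n a).comp
        (measurable_const.sub measurable_fst)).aestronglyMeasurable (.of_forall fun q => ?_)
    change ‖heatKer n (x - q.1) a‖ ≤ _
    rw [Real.norm_eq_abs, abs_of_pos (heatKer_pos n _ ha)]
    exact heatKer_le n _ ha
  rw [integral_integral_swap hI']
  refine setIntegral_congr_fun measurableSet_Ioi fun s hs => ?_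
  have hs' : 0 < s := hs
  change ∫ y : Euc n, heatKer n (x - y) a * oseenD n i j k y (t + s) = _
  rw [oseenD_semigroup n i j k x ha (add_pos ht hs'), add_assoc]

theorem integral_heatKer_mul_Kten_sub (n : ℕ) (hn : 2 ≤ n) (i j k : Fin n) (x z : Euc n) {a t : ℝ}
    (ha : 0 < a) (ht : 0 < t) :
    ∫ y : Euc n, heatKer n (x - y) a * Kten n i j k (y - z) t = Kten n i j k (x - z) (a + t) := by
  rw [← integral_heatKer_mul_Kten n hn i j k (x - z) ha ht,
    ← integral_sub_right_eq_self (fun y => heatKer n (x - z - y) a * Kten n i j k y t) z]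
  simp

theorem Kten_scaling (n : ℕ) (hn : 2 ≤ n) (i j k : Fin n) (x : Euc n) {lam t : ℝ} (hl : 0 < lam)
    (ht : 0 < t) :
    Kten n i j k (lam • x) (lam ^ 2 * t) = lam⁻¹ ^ (n + 1) * Kten n i j k x t := by
  obtain ⟨c, hc⟩ := exists_Kten_eq_integral_oseenD n hn
  have hl2 : 0 < lam ^ 2 := by positivity
  rw [hc i j k _ _ ht, hc i j k _ _ (mul_pos hl2 ht)]
  have h := integral_comp_mul_left_Ioi
    (fun s => oseenD n i j k (lam • x) (lam ^ 2 * t + s)) 0 hl2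
  rw [mul_zero, smul_eq_mul, eq_inv_mul_iff_mul_eq₀ hl2.ne'] at h
  have h2 : ∫ s in Set.Ioi (0 : ℝ), oseenD n i j k (lam • x) (lam ^ 2 * t + lam ^ 2 * s)
      = lam⁻¹ ^ (n + 3) * ∫ s in Set.Ioi (0 : ℝ), oseenD n i j k x (t + s) := by
    rw [← integral_const_mul]
    refine setIntegral_congr_fun measurableSet_Ioi fun s hs => ?_
    have hs' : 0 < s := hs
    change oseenD n i j k (lam • x) (lam ^ 2 * t + lam ^ 2 * s) = _
    rw [← mul_add, oseenD_scaling n i j k x hl (add_pos ht hs')]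
  rw [← h, h2, show n + 3 = (n + 1) + 2 by ring, pow_add]
  field_simp

instance isAddHaarMeasure_volume_euc_prod (n : ℕ) :
    Measure.IsAddHaarMeasure (volume : Measure (Euc n × ℝ)) :=
  inferInstanceAs (((volume : Measure (Euc n)).prod (volume : Measure ℝ)).IsAddHaarMeasure)

instance isNegInvariant_volume_euc_prod (n : ℕ) :
    Measure.IsNegInvariant (volume : Measure (Euc n × ℝ)) :=
  Measure.IsAddHaarMeasure.isNegInvariant_of_regular _

/-- The kernel `Kten` truncated to times in `(0, L]`. -/
def Kcut (n : ℕ) (L : ℝ) (i j k : Fin n) (q : Euc n × ℝ) : ℝ :=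
  if 0 < q.2 ∧ q.2 ≤ L then Kten n i j k q.1 q.2 else 0

theorem measurable_Kcut (n : ℕ) (hn : 2 ≤ n) (L : ℝ) (i j k : Fin n) :
    Measurable (Kcut n L i j k) := by
  have h : Kcut n L i j k = fun q => if q.2 ≤ L then
      (if 0 < q.2 then Kten n i j k q.1 q.2 else 0) else 0 := by
    funext q
    unfold Kcut
    split_ifs <;> first | rfl | (exfalso; tauto)
  rw [h]
  exact Measurable.ite (measurableSet_le measurable_snd measurable_const)
    (measurable_Kten_pos n hn i j k) measurable_const

theorem integrable_Kcut (n : ℕ) (hn : 2 ≤ n) (L : ℝ) (i j k : Fin n) :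
    Integrable (Kcut n L i j k) := by
  obtain ⟨C, hC0, hC⟩ := exists_Kten_integrable n hn
  have hsec : ∀ s ∈ Set.Ioc 0 L, (fun x => Kcut n L i j k (x, s)) = fun x => Kten n i j k x s :=
    fun s hs => funext fun x => if_pos hs
  have hg : IntegrableOn (fun s : ℝ => C * s ^ (-(1 / 2) : ℝ)) (Set.Ioc 0 L) := by
    rcases le_or_gt L 0 with h | h
    · simp [Set.Ioc_eq_empty (not_lt.2 h)]
    · exact ((intervalIntegral.intervalIntegrable_rpow' (by norm_num)).1).const_mul C
  have h := integrable_prod_of_section_le (μ := (volume : Measure (Euc n)))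
    (measurableSet_Ioc (a := (0 : ℝ)) (b := L)) (measurable_Kcut n hn L i j k)
    (fun s hs => by rw [hsec s hs]; exact (hC i j k s hs.1).1) hg
    (fun s hs => by
      simp_rw [fun x => congrFun (hsec s hs) x]
      exact (hC i j k s hs.1).2)
  have h1 := h.1
  rw [← Measure.restrict_univ (μ := (volume : Measure (Euc n))), Measure.prod_restrict,
    ← Measure.volume_eq_prod] at h1
  refine (integrableOn_iff_integrable_of_support_subset fun q hq => ?_).1 h1
  refine ⟨Set.mem_univ _, ?_⟩
  by_contra hc
  exact hq (if_neg hc)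

/-- The quadratic term `u_k u_j` truncated to times in `(t₀, t₁]`. -/
def quadCut (n : ℕ) (t₀ t₁ : ℝ) (w : Euc n → ℝ → Euc n) (j k : Fin n) (q : Euc n × ℝ) : ℝ :=
  if t₀ < q.2 ∧ q.2 ≤ t₁ then w q.1 q.2 k * w q.1 q.2 j else 0

theorem measurable_quadCut (n : ℕ) (t₀ t₁ : ℝ) {w : Euc n → ℝ → Euc n}
    (hw : Measurable (fun q : Euc n × ℝ => w q.1 q.2)) (j k : Fin n) :
    Measurable (quadCut n t₀ t₁ w j k) := by
  have h : ∀ i, Measurable (fun q : Euc n × ℝ => w q.1 q.2 i) :=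
    fun i => (measurable_coord n i).comp hw
  unfold quadCut
  exact Measurable.ite ((measurableSet_lt measurable_const measurable_snd).inter
    (measurableSet_le measurable_snd measurable_const)) ((h k).mul (h j)) measurable_const

theorem abs_quadCut_le (n : ℕ) {t₀ t₁ B : ℝ} {w : Euc n → ℝ → Euc n}
    (hB : ∀ x, ∀ t ∈ Set.Ioc t₀ t₁, ‖w x t‖ ≤ B) (j k : Fin n) (q : Euc n × ℝ) :
    |quadCut n t₀ t₁ w j k q| ≤ B ^ 2 := by
  unfold quadCut
  split_ifs with h
  · rw [abs_mul, sq]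
    have := hB q.1 q.2 h
    exact mul_le_mul ((abs_coord_le n _ k).trans this) ((abs_coord_le n _ j).trans this)
      (abs_nonneg _) ((norm_nonneg _).trans this)
  · rw [abs_zero]; positivity

/-- The space-time integrand of the nonlinear term in the mild formulation. -/
def duhamel (n : ℕ) (L t₀ t₁ : ℝ) (w : Euc n → ℝ → Euc n) (i : Fin n) (p q : Euc n × ℝ) : ℝ :=
  ∑ j, ∑ k, Kcut n L i j k (p - q) * quadCut n t₀ t₁ w j k q

theorem integrable_Kcut_mul_quadCut (n : ℕ) (hn : 2 ≤ n) (L : ℝ) {t₀ t₁ B : ℝ}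
    {w : Euc n → ℝ → Euc n} (hw : Measurable (fun q : Euc n × ℝ => w q.1 q.2))
    (hB : ∀ x, ∀ t ∈ Set.Ioc t₀ t₁, ‖w x t‖ ≤ B) (i j k : Fin n) (p : Euc n × ℝ) :
    Integrable (fun q => Kcut n L i j k (p - q) * quadCut n t₀ t₁ w j k q) :=
  ((integrable_Kcut n hn L i j k).comp_sub_left p).mul_bdd (c := B ^ 2)
    (measurable_quadCut n t₀ t₁ hw j k).aestronglyMeasurable
    (.of_forall fun q => abs_quadCut_le n hB j k q)

theorem integrable_duhamel (n : ℕ) (hn : 2 ≤ n) (L : ℝ) {t₀ t₁ B : ℝ}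
    {w : Euc n → ℝ → Euc n} (hw : Measurable (fun q : Euc n × ℝ => w q.1 q.2))
    (hB : ∀ x, ∀ t ∈ Set.Ioc t₀ t₁, ‖w x t‖ ≤ B) (i : Fin n) (p : Euc n × ℝ) :
    Integrable (duhamel n L t₀ t₁ w i p) :=
  integrable_finsetSum _ fun j _ => integrable_finsetSum _ fun k _ =>
    integrable_Kcut_mul_quadCut n hn L hw hB i j k p

theorem mild_nonlinear_eq (n : ℕ) (hn : 2 ≤ n) {L t₀ t₁ B : ℝ}
    {w : Euc n → ℝ → Euc n} (hw : Measurable (fun q : Euc n × ℝ => w q.1 q.2))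
    (hB : ∀ x, ∀ t ∈ Set.Ioc t₀ t₁, ‖w x t‖ ≤ B) (i : Fin n) (x : Euc n) {t : ℝ}
    (ht1 : t ≤ t₁) (hL : t - t₀ ≤ L) :
    ∫ s in Set.Ioo t₀ t, ∫ y : Euc n,
        ∑ j : Fin n, ∑ k : Fin n, Kten n i j k (x - y) (t - s) * w y s k * w y s j
      = ∫ q, duhamel n L t₀ t₁ w i (x, t) q := by
  have hI := integrable_duhamel n hn L hw hB i (x, t)
  rw [Measure.volume_eq_prod] at hI ⊢
  rw [integral_prod_symm _ hI, ← integral_indicator measurableSet_Ioo]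
  congr 1
  funext s
  by_cases hs : s ∈ Set.Ioo t₀ t
  · rw [Set.indicator_of_mem hs]
    congr 1
    funext y
    simp only [duhamel, Kcut, quadCut, Prod.fst_sub, Prod.snd_sub]
    refine Finset.sum_congr rfl fun j _ => Finset.sum_congr rfl fun k _ => ?_
    rw [if_pos (show t₀ < s ∧ s ≤ t₁ from ⟨hs.1, hs.2.le.trans ht1⟩),
      if_pos (show 0 < t - s ∧ t - s ≤ L from ⟨sub_pos.2 hs.2, by linarith [hs.1]⟩), mul_assoc]
  · rw [Set.indicator_of_notMem hs]
    symm
    refine integral_eq_zero_of_ae (.of_forall fun y => ?_)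
    refine Finset.sum_eq_zero fun j _ => Finset.sum_eq_zero fun k _ => ?_
    simp only [Kcut, quadCut, Prod.fst_sub, Prod.snd_sub]
    by_cases h1 : t₀ < s
    · have h2 : ¬ (0 < t - s ∧ t - s ≤ L) := fun h => hs ⟨h1, sub_pos.1 h.1⟩
      rw [if_neg h2, zero_mul]
    · have h2 : ¬ (t₀ < s ∧ s ≤ t₁) := fun h => h1 h.1
      rw [if_neg h2, mul_zero]

theorem integrable_mul_kernel {α β : Type*} [MeasurableSpace α] [MeasurableSpace β]
    {μ : Measure α} {ν : Measure β} [SFinite μ] [SFinite ν] {f : α → ℝ} {K : α × β → ℝ} {B : ℝ}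
    (hf : Integrable f μ) (hK : Measurable K) (hs : ∀ y, Integrable (fun z => K (y, z)) ν)
    (hB : ∀ y, ∫ z, |K (y, z)| ∂ν ≤ B) :
    Integrable (fun p : α × β => f p.1 * K p) (μ.prod ν) := by
  have hm : AEStronglyMeasurable (fun p : α × β => f p.1 * K p) (μ.prod ν) :=
    hf.1.comp_fst.mul hK.aestronglyMeasurable
  rw [integrable_prod_iff hm]
  refine ⟨.of_forall fun y => (hs y).const_mul (f y), ?_⟩
  refine (hf.norm.mul_const B).mono' hm.norm.integral_prod_right' (.of_forall fun y => ?_)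
  rw [Real.norm_eq_abs, abs_of_nonneg (integral_nonneg fun _ => norm_nonneg _)]
  simp_rw [norm_mul]
  rw [integral_const_mul]
  exact mul_le_mul_of_nonneg_left (hB y) (norm_nonneg _)

theorem heat_restart (n : ℕ) {f : Euc n → ℝ} {N a b : ℝ} (hf : Measurable f)
    (hN : ∀ x, |f x| ≤ N) (ha : 0 < a) (hb : 0 < b) (x : Euc n) :
    ∫ y : Euc n, heatKer n (x - y) a * ∫ z : Euc n, heatKer n (y - z) b * f z
      = ∫ z : Euc n, heatKer n (x - z) (a + b) * f z := by
  have hm : Measurable (fun p : Euc n × Euc n => heatKer n (p.1 - p.2) b * f p.2) :=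
    ((measurable_heatKer_left n b).comp (measurable_fst.sub measurable_snd)).mul
      (hf.comp measurable_snd)
  have hs : ∀ y : Euc n, Integrable (fun z => heatKer n (y - z) b * f z) := fun y =>
    (integrable_heatKer_sub n y hb).mul_bdd (c := N) hf.aestronglyMeasurable (.of_forall hN)
  have hB : ∀ y : Euc n, ∫ z, |heatKer n (y - z) b * f z| ≤ N := by
    intro y
    refine (integral_mono (hs y).abs ((integrable_heatKer_sub n y hb).mul_const N)
      fun z => ?_).trans (le_of_eq ?_)
    · change |heatKer n (y - z) b * f z| ≤ heatKer n (y - z) b * N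
      rw [abs_mul, abs_of_pos (heatKer_pos n _ hb)]
      exact mul_le_mul_of_nonneg_left (hN z) (heatKer_pos n _ hb).le
    · rw [integral_mul_const, integral_heatKer_sub n y hb, one_mul]
  have hI := integrable_mul_kernel (integrable_heatKer_sub n x ha) hm hs hB
  simp_rw [← integral_const_mul]
  rw [integral_integral_swap hI]
  congr 1
  funext z
  simp_rw [← mul_assoc]
  rw [integral_mul_const, integral_heatKer_mul_heatKer n x z ha hb]

theorem integral_heatKer_mul_Kcut (n : ℕ) (hn : 2 ≤ n) (L L' : ℝ) (i j k : Fin n) (x : Euc n)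
    {a t s : ℝ} (ha : 0 < a) (hts : 0 < t - s) (hL : t - s ≤ L) (hL' : a + t - s ≤ L') (z : Euc n) :
    ∫ y : Euc n, heatKer n (x - y) a * Kcut n L i j k ((y, t) - (z, s))
      = Kcut n L' i j k ((x, a + t) - (z, s)) := by
  have e1 : ∀ y : Euc n, Kcut n L i j k ((y, t) - (z, s)) = Kten n i j k (y - z) (t - s) :=
    fun y => if_pos ⟨hts, hL⟩
  have e2 : Kcut n L' i j k ((x, a + t) - (z, s)) = Kten n i j k (x - z) (a + t - s) :=
    if_pos ⟨by change 0 < a + t - s; linarith, hL'⟩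
  simp_rw [e1]
  rw [e2, integral_heatKer_mul_Kten_sub n hn i j k x z ha hts, add_sub_assoc]

theorem ae_snd_ne (n : ℕ) (t : ℝ) : ∀ᵐ q : Euc n × ℝ, q.2 ≠ t := by
  have h : ∀ᵐ s : ℝ, s ≠ t := compl_mem_ae_iff.2 (measure_singleton t)
  exact Measure.quasiMeasurePreserving_snd.ae h

theorem heat_duhamel (n : ℕ) (hn : 2 ≤ n) {L L' t₀ B : ℝ} {w : Euc n → ℝ → Euc n}
    (hw : Measurable (fun q : Euc n × ℝ => w q.1 q.2)) {t a : ℝ}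
    (hB : ∀ x, ∀ s ∈ Set.Ioc t₀ t, ‖w x s‖ ≤ B) (i : Fin n) (x : Euc n) (ha : 0 < a)
    (hL : t - t₀ ≤ L) (hL' : a + t - t₀ ≤ L') :
    ∫ y : Euc n, heatKer n (x - y) a * ∫ q, duhamel n L t₀ t w i (y, t) q
      = ∫ q, duhamel n L' t₀ t w i (x, a + t) q := by
  have hK := fun j k => integrable_Kcut n hn L i j k
  have hm1 : Measurable fun p : Euc n × (Euc n × ℝ) => (p.1, t) - p.2 :=
    (measurable_fst.prodMk measurable_const).sub measurable_snd
  have hm : ∀ j k, Measurable (fun p : Euc n × (Euc n × ℝ) =>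
      Kcut n L i j k ((p.1, t) - p.2) * quadCut n t₀ t w j k p.2) := fun j k =>
    ((measurable_Kcut n hn L i j k).comp hm1).mul
      ((measurable_quadCut n t₀ t hw j k).comp measurable_snd)
  have hs := fun j k (y : Euc n) => integrable_Kcut_mul_quadCut n hn L hw hB i j k (y, t)
  have hBd : ∀ j k (y : Euc n), ∫ q, |Kcut n L i j k ((y, t) - q) * quadCut n t₀ t w j k q|
      ≤ (∫ q, |Kcut n L i j k q|) * B ^ 2 := by
    intro j k y
    rw [← integral_sub_left_eq_self (fun q => |Kcut n L i j k q|) volume (y, t),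
      ← integral_mul_const]
    refine integral_mono (hs j k y).abs (((hK j k).comp_sub_left (y, t)).abs.mul_const _)
      fun q => ?_
    change |_ * _| ≤ _
    rw [abs_mul]
    exact mul_le_mul_of_nonneg_left (abs_quadCut_le n hB j k q) (abs_nonneg _)
  have hI := fun j k => integrable_mul_kernel (integrable_heatKer_sub n x ha) (hm j k) (hs j k)
    (hBd j k)
  have hI' : Integrable (fun p : Euc n × (Euc n × ℝ) => heatKer n (x - p.1) a
      * duhamel n L t₀ t w i (p.1, t) p.2) (volume.prod volume) := by
    simp_rw [duhamel, Finset.mul_sum]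
    exact integrable_finsetSum _ fun j _ => integrable_finsetSum _ fun k _ => hI j k
  simp_rw [← integral_const_mul]
  rw [integral_integral_swap hI']
  refine integral_congr_ae ((ae_snd_ne n t).mono fun q hq => ?_)
  obtain ⟨z, s⟩ := q
  simp only [duhamel, Finset.mul_sum]
  by_cases hst : t₀ < s ∧ s ≤ t
  · have hts : 0 < t - s := sub_pos.2 (lt_of_le_of_ne hst.2 hq)
    have hi : ∀ j k, Integrable (fun y => heatKer n (x - y) a
        * (Kcut n L i j k ((y, t) - (z, s)) * quadCut n t₀ t w j k (z, s))) := by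
      intro j k
      simp_rw [← mul_assoc]
      refine (Integrable.heatKer_mul ?_ x ha).mul_const _
      obtain ⟨C, -, hC⟩ := exists_Kten_integrable n hn
      have e1 : (fun y : Euc n => Kcut n L i j k ((y, t) - (z, s)))
          = fun y => Kten n i j k (y - z) (t - s) :=
        funext fun y => if_pos ⟨hts, by change t - s ≤ L; linarith [hst.1]⟩
      rw [e1]
      exact (hC i j k _ hts).1.comp_sub_right z
    rw [integral_finsetSum _ fun j _ => integrable_finsetSum _ fun k _ => hi j k]
    refine Finset.sum_congr rfl fun j _ => ?_
    rw [integral_finsetSum _ fun k _ => hi j k]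
    refine Finset.sum_congr rfl fun k _ => ?_
    simp_rw [← mul_assoc]
    rw [integral_mul_const, integral_heatKer_mul_Kcut n hn L L' i j k x ha hts
      (by linarith [hst.1]) (by linarith [hst.1])]
  · have h0 : ∀ j k, quadCut n t₀ t w j k (z, s) = 0 := fun j k => if_neg hst
    simp [h0]

theorem duhamel_add (n : ℕ) (hn : 2 ≤ n) {L a t₀ t B : ℝ} {w : Euc n → ℝ → Euc n}
    (hw : Measurable (fun q : Euc n × ℝ => w q.1 q.2))
    (hB : ∀ x, ∀ s ∈ Set.Ioc a t, ‖w x s‖ ≤ B) (ha : a ≤ t₀) (ht : t₀ ≤ t) (i : Fin n)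
    (p : Euc n × ℝ) :
    ∫ q, duhamel n L a t w i p q
      = (∫ q, duhamel n L a t₀ w i p q) + ∫ q, duhamel n L t₀ t w i p q := by
  rw [← integral_add
    (integrable_duhamel n hn L hw (fun x s hs => hB x s ⟨hs.1, hs.2.trans ht⟩) i p)
    (integrable_duhamel n hn L hw (fun x s hs => hB x s ⟨ha.trans_lt hs.1, hs.2⟩) i p)]
  congr 1
  funext q
  simp only [duhamel, ← Finset.sum_add_distrib, ← mul_add]
  refine Finset.sum_congr rfl fun j _ => Finset.sum_congr rfl fun k _ => ?_
  congr 1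
  unfold quadCut
  by_cases h1 : a < q.2 <;> by_cases h2 : q.2 ≤ t₀ <;> by_cases h3 : t₀ < q.2 <;>
    by_cases h4 : q.2 ≤ t <;> simp [h1, h2, h3, h4] <;> linarith

theorem mild_eq_duhamel (n : ℕ) (hn : 2 ≤ n) {L a T B : ℝ} {ua : Euc n → Euc n}
    {u : Euc n → ℝ → Euc n} (hu : Measurable (fun q : Euc n × ℝ => u q.1 q.2))
    (h : IsMildNS n a T ua u) {t t₁ : ℝ} (ht : t ∈ Set.Ioo a T) (ht1 : t ≤ t₁)
    (hB : ∀ x, ∀ s ∈ Set.Ioc a t₁, ‖u x s‖ ≤ B) (hL : t - a ≤ L) (x : Euc n) (i : Fin n) :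
    u x t i = (∫ y : Euc n, heatKer n (x - y) (t - a) * ua y i)
      - ∫ q, duhamel n L a t₁ u i (x, t) q := by
  rw [h x t ht i, mild_nonlinear_eq n hn hu hB i x ht1 hL]

theorem abs_integral_duhamel_le (n : ℕ) (hn : 2 ≤ n) (L : ℝ) (i : Fin n) : ∃ C, ∀ {t₀ t₁ B : ℝ}
    {w : Euc n → ℝ → Euc n}, Measurable (fun q : Euc n × ℝ => w q.1 q.2) →
    (∀ x, ∀ s ∈ Set.Ioc t₀ t₁, ‖w x s‖ ≤ B) → ∀ p,
      |∫ q, duhamel n L t₀ t₁ w i p q| ≤ C * B ^ 2 := by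
  refine ⟨∑ j, ∑ k, ∫ q, |Kcut n L i j k q|, fun {t₀ t₁ B w} hw hB p => ?_⟩
  have hK := fun j k => ((integrable_Kcut n hn L i j k).comp_sub_left p).abs
  have hI : Integrable fun q => ∑ j, ∑ k, |Kcut n L i j k (p - q)| * B ^ 2 :=
    integrable_finsetSum _ fun j _ => integrable_finsetSum _ fun k _ => (hK j k).mul_const _
  refine abs_integral_le_integral_abs.trans
    ((integral_mono (integrable_duhamel n hn L hw hB i p).abs hI fun q => ?_).trans
      (le_of_eq ?_))
  · refine (Finset.abs_sum_le_sum_abs _ _).trans (Finset.sum_le_sum fun j _ => ?_)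
    refine (Finset.abs_sum_le_sum_abs _ _).trans (Finset.sum_le_sum fun k _ => ?_)
    rw [abs_mul]
    exact mul_le_mul_of_nonneg_left (abs_quadCut_le n hB j k q) (abs_nonneg _)
  · rw [integral_finsetSum _ fun j _ => integrable_finsetSum _ fun k _ => (hK j k).mul_const _,
      Finset.sum_mul]
    refine Finset.sum_congr rfl fun j _ => ?_
    rw [integral_finsetSum _ fun k _ => (hK j k).mul_const _, Finset.sum_mul]
    refine Finset.sum_congr rfl fun k _ => ?_
    rw [integral_mul_const, integral_sub_left_eq_self (fun q => |Kcut n L i j k q|) volume p]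

theorem IsMildNS.restart {n : ℕ} (hn : 2 ≤ n) {a T N : ℝ} {ua : Euc n → Euc n}
    {u : Euc n → ℝ → Euc n} (hua : Measurable ua) (hN : ∀ x, ‖ua x‖ ≤ N)
    (hu : Measurable (fun q : Euc n × ℝ => u q.1 q.2))
    (hB : ∀ T' ∈ Set.Ioo a T, ∃ M : ℝ, ∀ x, ∀ t ∈ Set.Ioc a T', ‖u x t‖ ≤ M)
    (h : IsMildNS n a T ua u) {t₀ : ℝ} (ht₀ : t₀ ∈ Set.Ioo a T) :
    IsMildNS n t₀ T (fun x => u x t₀) u := by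
  intro x t ht i
  obtain ⟨M, hM⟩ := hB t ⟨ht₀.1.trans ht.1, ht.2⟩
  have hM0 : ∀ x, ∀ s ∈ Set.Ioc a t₀, ‖u x s‖ ≤ M := fun x s hs => hM x s ⟨hs.1, hs.2.trans ht.1.le⟩
  have hM1 : ∀ x, ∀ s ∈ Set.Ioc t₀ t, ‖u x s‖ ≤ M := fun x s hs => hM x s ⟨ht₀.1.trans hs.1, hs.2⟩
  have e0 := fun y => mild_eq_duhamel n hn (L := t - a) hu h ht₀ le_rfl hM0 (by linarith [ht.1]) y i
  have e1 := mild_eq_duhamel n hn (L := t - a) hu h ⟨ht₀.1.trans ht.1, ht.2⟩ le_rfl hM le_rfl x i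
  have hpos : 0 < t - t₀ := sub_pos.2 ht.1
  have hpos' : 0 < t₀ - a := sub_pos.2 ht₀.1
  have hNi : ∀ y, |ua y i| ≤ N := fun y => (abs_coord_le n _ i).trans (hN y)
  have hmi : Measurable fun y => ua y i := (measurable_coord n i).comp hua
  obtain ⟨C, hC⟩ := abs_integral_duhamel_le n hn (t - a) i
  have hd := fun y : Euc n => hC hu hM0 (y, t₀)
  have hmt : Measurable fun y => u y t₀ i :=
    (measurable_coord n i).comp (hu.comp (measurable_id.prodMk measurable_const))
  have hheat : ∀ y : Euc n, |∫ z : Euc n, heatKer n (y - z) (t₀ - a) * ua z i| ≤ N := by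
    intro y
    refine (abs_integral_le_integral_abs).trans ((integral_mono
      (((integrable_heatKer_sub n y hpos').mul_bdd (c := N) hmi.aestronglyMeasurable
        (.of_forall hNi)).abs) ((integrable_heatKer_sub n y hpos').mul_const N)
      fun z => ?_).trans (le_of_eq ?_))
    · change |heatKer n (y - z) _ * ua z i| ≤ heatKer n (y - z) _ * N
      rw [abs_mul, abs_of_pos (heatKer_pos n _ hpos')]
      exact mul_le_mul_of_nonneg_left (hNi z) (heatKer_pos n _ hpos').le
    · rw [integral_mul_const, integral_heatKer_sub n y hpos', one_mul]
  have hmh : Measurable fun y : Euc n => ∫ z : Euc n, heatKer n (y - z) (t₀ - a) * ua z i := by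
    have : Measurable (fun p : Euc n × Euc n => heatKer n (p.1 - p.2) (t₀ - a) * ua p.2 i) :=
      ((measurable_heatKer_left n _).comp (measurable_fst.sub measurable_snd)).mul
        (hmi.comp measurable_snd)
    exact (this.stronglyMeasurable.integral_prod_right').measurable
  have hmd : Measurable fun y : Euc n => ∫ q, duhamel n (t - a) a t₀ u i (y, t₀) q := by
    have : (fun y : Euc n => ∫ q, duhamel n (t - a) a t₀ u i (y, t₀) q) = fun y =>
        (∫ z : Euc n, heatKer n (y - z) (t₀ - a) * ua z i) - u y t₀ i := by
      funext y
      rw [e0 y]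
      ring
    rw [this]
    exact hmh.sub hmt
  have key : ∫ y : Euc n, heatKer n (x - y) (t - t₀) * u y t₀ i
      = (∫ z : Euc n, heatKer n (x - z) (t - a) * ua z i)
        - ∫ q, duhamel n (t - a) a t₀ u i (x, t) q := by
    simp_rw [e0, mul_sub]
    rw [integral_sub
      ((integrable_heatKer_sub n x hpos).mul_bdd (c := N) hmh.aestronglyMeasurable
        (.of_forall hheat))
      ((integrable_heatKer_sub n x hpos).mul_bdd (c := C * M ^ 2) hmd.aestronglyMeasurable
        (.of_forall hd)),
      heat_restart n hmi hNi hpos hpos' x,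
      heat_duhamel n hn (L' := t - a) hu hM0 i x hpos (by linarith [ht.1]) (by linarith)]
    congr 2
    · ring_nf
    · ring_nf
  rw [key, e1, mild_nonlinear_eq n hn (L := t - a) hu hM1 i x le_rfl (by linarith [ht₀.1]),
    duhamel_add n hn hu hM ht₀.1.le ht.1.le i (x, t)]
  ring

theorem integral_eq_rescale (n : ℕ) (F : Euc n → ℝ) (x₀ : Euc n) {lam : ℝ} (hl : 0 < lam) :
    ∫ z, F z = lam ^ n * ∫ z, F (x₀ + lam • z) := by
  have h := Measure.integral_comp_smul (volume : Measure (Euc n)) (fun z => F (x₀ + z)) lam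
  rw [h, integral_add_left_eq_self F x₀, finrank_euclideanSpace_fin, abs_of_pos (by positivity),
    smul_eq_mul, ← mul_assoc, mul_inv_cancel₀ (by positivity), one_mul]

theorem setIntegral_Ioo_eq_rescale (F : ℝ → ℝ) (t₀ : ℝ) {a b l : ℝ} (hl : 0 < l) (hab : a ≤ b) :
    ∫ s in Set.Ioo a b, F s
      = l * ∫ r in Set.Ioo ((a - t₀) / l) ((b - t₀) / l), F (t₀ + l * r) := by
  have hab' : (a - t₀) / l ≤ (b - t₀) / l := by gcongr
  rw [← integral_Ioc_eq_integral_Ioo, ← integral_Ioc_eq_integral_Ioo,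
    ← intervalIntegral.integral_of_le hab, ← intervalIntegral.integral_of_le hab',
    intervalIntegral.integral_comp_add_mul F hl.ne' t₀, smul_eq_mul, ← mul_assoc,
    mul_inv_cancel₀ hl.ne', one_mul]
  congr 1 <;> field_simp <;> ring

theorem IsMildNS.rescale {n : ℕ} (hn : 2 ≤ n) {a T : ℝ} {ua : Euc n → Euc n}
    {u : Euc n → ℝ → Euc n} (h : IsMildNS n a T ua u) (x₀ : Euc n) (t₀ : ℝ) {lam : ℝ}
    (hl : 0 < lam) :
    IsMildNS n ((a - t₀) / lam ^ 2) ((T - t₀) / lam ^ 2) (fun y => lam • ua (x₀ + lam • y))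
      (fun y s => lam • u (x₀ + lam • y) (t₀ + lam ^ 2 * s)) := by
  have hl2 : 0 < lam ^ 2 := by positivity
  intro x t ht i
  have h1 : a < t₀ + lam ^ 2 * t := by
    have := (div_lt_iff₀' hl2).1 ht.1
    linarith
  have h2 : t₀ + lam ^ 2 * t < T := by
    have := (lt_div_iff₀' hl2).1 ht.2
    linarith
  have key := h (x₀ + lam • x) (t₀ + lam ^ 2 * t) ⟨h1, h2⟩ i
  have hsub : ∀ y : Euc n, x₀ + lam • x - (x₀ + lam • y) = lam • (x - y) := fun y => by
    rw [smul_sub]; abel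
  simp only [PiLp.smul_apply, smul_eq_mul]
  rw [key, mul_sub]
  congr 1
  · rw [integral_eq_rescale n _ x₀ hl, ← integral_const_mul, ← integral_const_mul]
    congr 1
    funext y
    have hpos : 0 < t - (a - t₀) / lam ^ 2 := sub_pos.2 ht.1
    have e : t₀ + lam ^ 2 * t - a = lam ^ 2 * (t - (a - t₀) / lam ^ 2) := by field_simp; ring
    rw [hsub, e, heatKer_scaling n _ hl hpos, inv_pow]
    field_simp
  · rw [setIntegral_Ioo_eq_rescale _ t₀ hl2 h1.le, ← integral_const_mul, ← integral_const_mul,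
      add_sub_cancel_left, mul_div_cancel_left₀ _ hl2.ne']
    refine setIntegral_congr_fun measurableSet_Ioo fun s hs => ?_
    have hs' : 0 < t - s := sub_pos.2 hs.2
    have e : t₀ + lam ^ 2 * t - (t₀ + lam ^ 2 * s) = lam ^ 2 * (t - s) := by ring
    simp only
    rw [integral_eq_rescale n _ x₀ hl, ← integral_const_mul, ← integral_const_mul,
      ← integral_const_mul]
    congr 1
    funext y
    simp only [Finset.mul_sum]
    refine Finset.sum_congr rfl fun j _ => Finset.sum_congr rfl fun k _ => ?_
    rw [hsub, e, Kten_scaling n hn i j k _ hl hs', inv_pow]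
    field_simp
    ring

theorem tendsto_integral_abs_sub_translate_of_continuous {n : ℕ} {g : Euc n × ℝ → ℝ}
    (hg : Continuous g) (hc : HasCompactSupport g) (p₀ : Euc n × ℝ) :
    Tendsto (fun p => ∫ q, |g (p - q) - g (p₀ - q)|) (𝓝 p₀) (𝓝 0) := by
  obtain ⟨R, hR⟩ := hc.isCompact.isBounded.subset_closedBall 0
  obtain ⟨M, hM⟩ := hc.exists_bound_of_continuous hg
  have h0 : ∀ z : Euc n × ℝ, R < ‖z‖ → g z = 0 := by
    intro z hz
    by_contra h
    have := hR (subset_tsupport g h)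
    rw [mem_closedBall_zero_iff] at this
    linarith
  have key : Tendsto (fun p => ∫ q, |g (p - q) - g (p₀ - q)|) (𝓝 p₀)
      (𝓝 (∫ _ : Euc n × ℝ, (0 : ℝ))) := by
    refine tendsto_integral_filter_of_dominated_convergence
      ((Metric.closedBall p₀ (R + 1)).indicator fun _ => 2 * M) (.of_forall fun p => ?_) ?_ ?_ ?_
    · exact (((hg.comp (continuous_const.sub continuous_id)).sub
        (hg.comp (continuous_const.sub continuous_id))).abs).aestronglyMeasurable
    · filter_upwards [Metric.ball_mem_nhds p₀ one_pos] with p hp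
      refine .of_forall fun q => ?_
      rw [Real.norm_eq_abs, abs_abs]
      by_cases hq : q ∈ Metric.closedBall p₀ (R + 1)
      · rw [Set.indicator_of_mem hq, two_mul]
        exact (abs_sub _ _).trans (add_le_add (hM _) (hM _))
      · rw [Set.indicator_of_notMem hq]
        rw [Metric.mem_closedBall, dist_eq_norm, not_le] at hq
        rw [mem_ball_iff_norm] at hp
        have e1 : ‖q - p₀‖ ≤ ‖p₀ - q‖ := (norm_sub_rev _ _).le
        have e2 : ‖q - p₀‖ ≤ ‖p - q‖ + ‖p - p₀‖ := by
          have := norm_sub_le (p - p₀) (p - q)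
          rw [sub_sub_sub_cancel_left] at this
          linarith
        rw [h0 _ (show R < ‖p - q‖ by linarith), h0 _ (show R < ‖p₀ - q‖ by linarith)]
        simp
    · exact (integrable_indicator_iff Metric.isClosed_closedBall.measurableSet).2
        (integrableOn_const (measure_closedBall_lt_top).ne)
    · refine .of_forall fun q => ?_
      have : Continuous fun p => |g (p - q) - g (p₀ - q)| :=
        ((hg.comp (continuous_id.sub continuous_const)).sub continuous_const).abs
      simpa using this.tendsto p₀
  simpa using key

theorem tendsto_integral_abs_sub_translate {n : ℕ} {H : Euc n × ℝ → ℝ} (hH : Integrable H)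
    (p₀ : Euc n × ℝ) : Tendsto (fun p => ∫ q, |H (p - q) - H (p₀ - q)|) (𝓝 p₀) (𝓝 0) := by
  rw [Metric.tendsto_nhds]
  intro ε hε
  obtain ⟨g, hgc, hgε, hgcont, hgI⟩ :=
    hH.exists_hasCompactSupport_integral_sub_le (show 0 < ε / 4 by positivity)
  have hg := (Metric.tendsto_nhds.1
    (tendsto_integral_abs_sub_translate_of_continuous hgcont hgc p₀)) (ε / 4) (by positivity)
  filter_upwards [hg] with p hp
  rw [Real.dist_0_eq_abs, abs_of_nonneg (integral_nonneg fun _ => abs_nonneg _)] at hp ⊢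
  have hd := fun p => ((hH.sub hgI).comp_sub_left p).abs
  have hd' : ∀ p, ∫ q, |(H - g) (p - q)| ≤ ε / 4 := fun p => by
    rw [integral_sub_left_eq_self (fun q => |(H - g) q|) volume p]
    exact hgε
  have hgd : Integrable fun q => |g (p - q) - g (p₀ - q)| :=
    ((hgI.comp_sub_left p).sub (hgI.comp_sub_left p₀)).abs
  have hle : ∫ q, |H (p - q) - H (p₀ - q)|
      ≤ ∫ q, (|(H - g) (p - q)| + |(H - g) (p₀ - q)| + |g (p - q) - g (p₀ - q)|) := by
    refine integral_mono ((hH.comp_sub_left p).sub (hH.comp_sub_left p₀)).abs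
      (((hd p).add (hd p₀)).add hgd) fun q => ?_
    simp only [Pi.sub_apply]
    have e : H (p - q) - H (p₀ - q) = (H (p - q) - g (p - q)) - (H (p₀ - q) - g (p₀ - q))
        + (g (p - q) - g (p₀ - q)) := by ring
    change |H (p - q) - H (p₀ - q)| ≤ _
    rw [e]
    exact (abs_add_le _ _).trans (add_le_add (abs_sub _ _) le_rfl)
  have hdd : Integrable fun q => |(H - g) (p - q)| + |(H - g) (p₀ - q)| := (hd p).add (hd p₀)
  rw [integral_add hdd hgd, integral_add (hd p) (hd p₀)] at hle
  linarith [hd' p, hd' p₀]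

theorem continuousAt_heatKer (n : ℕ) {p : Euc n × ℝ} (hp : 0 < p.2) :
    ContinuousAt (fun q : Euc n × ℝ => heatKer n q.1 q.2) p := by
  unfold heatKer
  refine ContinuousAt.mul (ContinuousAt.rpow_const (by fun_prop) (Or.inl (by positivity))) ?_
  refine Real.continuous_exp.continuousAt.comp (ContinuousAt.div (by fun_prop) (by fun_prop)
    (by positivity))

theorem tendsto_integral_abs_heatKer_sub (n : ℕ) {p₀ : Euc n × ℝ} {S : ℝ} (hp₀ : S < p₀.2) :
    Tendsto (fun p : Euc n × ℝ =>
      ∫ y : Euc n, |heatKer n (p.1 - y) (p.2 - S) - heatKer n (p₀.1 - y) (p₀.2 - S)|)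
      (𝓝 p₀) (𝓝 0) := by
  have hev : ∀ᶠ p : Euc n × ℝ in 𝓝 p₀, 0 < p.2 - S :=
    ((continuous_snd.tendsto p₀).eventually (lt_mem_nhds hp₀)).mono fun p hp => sub_pos.2 hp
  have hp₀' : 0 < p₀.2 - S := sub_pos.2 hp₀
  have hm : ∀ p : Euc n × ℝ, Measurable fun y : Euc n => heatKer n (p.1 - y) (p.2 - S) := fun p =>
    (measurable_heatKer_left n _).comp (measurable_const.sub measurable_id)
  have h1 : Tendsto (fun p : Euc n × ℝ => ∫ y : Euc n,
      min (heatKer n (p.1 - y) (p.2 - S)) (heatKer n (p₀.1 - y) (p₀.2 - S))) (𝓝 p₀)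
      (𝓝 (∫ y : Euc n, heatKer n (p₀.1 - y) (p₀.2 - S))) := by
    refine tendsto_integral_filter_of_dominated_convergence _
      (.of_forall fun p => ((hm p).min (hm p₀)).aestronglyMeasurable) ?_
      (integrable_heatKer_sub n p₀.1 hp₀') (.of_forall fun y => ?_)
    · filter_upwards [hev] with p hp
      refine .of_forall fun y => ?_
      rw [Real.norm_eq_abs,
        abs_of_nonneg (le_min (heatKer_pos n _ hp).le (heatKer_pos n _ hp₀').le)]
      exact min_le_right _ _
    · have hf : ContinuousAt (fun p : Euc n × ℝ => (p.1 - y, p.2 - S)) p₀ := by fun_prop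
      have hc : ContinuousAt (fun p : Euc n × ℝ => heatKer n (p.1 - y) (p.2 - S)) p₀ :=
        ContinuousAt.comp (f := fun p : Euc n × ℝ => (p.1 - y, p.2 - S))
          (g := fun q : Euc n × ℝ => heatKer n q.1 q.2) (continuousAt_heatKer n hp₀') hf
      simpa using hc.tendsto.min (tendsto_const_nhds (x := heatKer n (p₀.1 - y) (p₀.2 - S)))
  rw [integral_heatKer_sub n p₀.1 hp₀'] at h1
  have h2 := (h1.const_mul 2).const_sub 2
  rw [mul_one, sub_self] at h2
  refine h2.congr' ?_
  filter_upwards [hev] with p hp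
  have i1 := integrable_heatKer_sub n p.1 hp
  have i2 := integrable_heatKer_sub n p₀.1 hp₀'
  have e : ∀ a b : ℝ, |a - b| = a + b - 2 * min a b := by
    intro a b
    rcases le_total a b with h | h
    · rw [min_eq_left h, abs_of_nonpos (by linarith)]; ring
    · rw [min_eq_right h, abs_of_nonneg (by linarith)]; ring
  simp_rw [e]
  have i3 : Integrable fun y : Euc n =>
      heatKer n (p.1 - y) (p.2 - S) + heatKer n (p₀.1 - y) (p₀.2 - S) := i1.add i2
  have i4 : Integrable fun y : Euc n =>
      2 * min (heatKer n (p.1 - y) (p.2 - S)) (heatKer n (p₀.1 - y) (p₀.2 - S)) :=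
    (i1.inf i2).const_mul 2
  rw [integral_sub i3 i4, integral_add i1 i2, integral_heatKer_sub n p.1 hp,
    integral_heatKer_sub n p₀.1 hp₀', integral_const_mul]
  norm_num

theorem norm_le_sum_abs (n : ℕ) (v : Euc n) : ‖v‖ ≤ ∑ i, |v i| := by
  have h : ∑ i, EuclideanSpace.single i (v i) = v := by
    ext j
    simp [Finset.sum_apply, Pi.single_apply]
  calc ‖v‖ = ‖∑ i, EuclideanSpace.single i (v i)‖ := by rw [h]
    _ ≤ ∑ i, ‖(EuclideanSpace.single i (v i) : Euc n)‖ := norm_sum_le _ _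
    _ = ∑ i, |v i| := by simp

theorem abs_heat_sub_le (n : ℕ) {f : Euc n → ℝ} (hf : Measurable f) (h1 : ∀ x, |f x| ≤ 1)
    (x x₀ : Euc n) {t t₀ : ℝ} (ht : 0 < t) (ht₀ : 0 < t₀) :
    |(∫ y : Euc n, heatKer n (x - y) t * f y) - ∫ y : Euc n, heatKer n (x₀ - y) t₀ * f y|
      ≤ ∫ y : Euc n, |heatKer n (x - y) t - heatKer n (x₀ - y) t₀| := by
  have i1 := integrable_heatKer_sub n x ht
  have i2 := integrable_heatKer_sub n x₀ ht₀
  have i3 := i1.mul_bdd (c := 1) hf.aestronglyMeasurable (.of_forall h1)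
  have i4 := i2.mul_bdd (c := 1) hf.aestronglyMeasurable (.of_forall h1)
  rw [← integral_sub i3 i4]
  refine abs_integral_le_integral_abs.trans (integral_mono (i3.sub i4).abs (i1.sub i2).abs
    fun y => ?_)
  change |heatKer n (x - y) t * f y - heatKer n (x₀ - y) t₀ * f y|
    ≤ |heatKer n (x - y) t - heatKer n (x₀ - y) t₀|
  rw [← sub_mul, abs_mul]
  exact mul_le_of_le_one_right (abs_nonneg _) (h1 y)

theorem abs_duhamel_sub_le (n : ℕ) (hn : 2 ≤ n) (L : ℝ) {t₀ t₁ : ℝ} {w : Euc n → ℝ → Euc n}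
    (hw : Measurable (fun q : Euc n × ℝ => w q.1 q.2))
    (hB : ∀ x, ∀ s ∈ Set.Ioc t₀ t₁, ‖w x s‖ ≤ 1) (i : Fin n) (p p₀ : Euc n × ℝ) :
    |(∫ q, duhamel n L t₀ t₁ w i p q) - ∫ q, duhamel n L t₀ t₁ w i p₀ q|
      ≤ ∑ j, ∑ k, ∫ q, |Kcut n L i j k (p - q) - Kcut n L i j k (p₀ - q)| := by
  have i1 := integrable_duhamel n hn L hw hB i p
  have i2 := integrable_duhamel n hn L hw hB i p₀
  have i3 : ∀ j k, Integrable fun q => |Kcut n L i j k (p - q) - Kcut n L i j k (p₀ - q)| :=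
    fun j k => (((integrable_Kcut n hn L i j k).comp_sub_left p).sub
      ((integrable_Kcut n hn L i j k).comp_sub_left p₀)).abs
  have i4 : ∀ j, Integrable fun q => ∑ k, |Kcut n L i j k (p - q) - Kcut n L i j k (p₀ - q)| :=
    fun j => integrable_finsetSum _ fun k _ => i3 j k
  have e : ∑ j, ∑ k, ∫ q, |Kcut n L i j k (p - q) - Kcut n L i j k (p₀ - q)|
      = ∫ q, ∑ j, ∑ k, |Kcut n L i j k (p - q) - Kcut n L i j k (p₀ - q)| := by
    rw [integral_finsetSum _ fun j _ => i4 j]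
    exact Finset.sum_congr rfl fun j _ => (integral_finsetSum _ fun k _ => i3 j k).symm
  rw [← integral_sub i1 i2, e]
  refine abs_integral_le_integral_abs.trans (integral_mono (i1.sub i2).abs
    (integrable_finsetSum _ fun j _ => i4 j) fun q => ?_)
  change |duhamel n L t₀ t₁ w i p q - duhamel n L t₀ t₁ w i p₀ q| ≤ _
  simp only [duhamel, ← Finset.sum_sub_distrib, ← sub_mul]
  refine (Finset.abs_sum_le_sum_abs _ _).trans (Finset.sum_le_sum fun j _ => ?_)
  refine (Finset.abs_sum_le_sum_abs _ _).trans (Finset.sum_le_sum fun k _ => ?_)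
  rw [abs_mul]
  refine mul_le_of_le_one_right (abs_nonneg _) ?_
  simpa using abs_quadCut_le n hB j k q

theorem measurable_slice (n : ℕ) {w : Euc n → ℝ → Euc n}
    (hw : Measurable (fun q : Euc n × ℝ => w q.1 q.2)) (s : ℝ) (i : Fin n) :
    Measurable fun y => w y s i :=
  have h : Measurable fun y => w y s := hw.comp (measurable_id.prodMk measurable_const)
  (measurable_coord n i).comp h

theorem exists_equicontinuous_mild (n : ℕ) (hn : 2 ≤ n) (p₀ : Euc n × ℝ) (hp₀ : p₀.2 ≤ 0) {ε : ℝ}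
    (hε : 0 < ε) : ∃ U ∈ 𝓝 p₀, ∀ (w : Euc n → ℝ → Euc n) (b : ℝ),
      Measurable (fun q : Euc n × ℝ => w q.1 q.2) → 0 < b →
      IsMildNS n (p₀.2 - 1) b (fun x => w x (p₀.2 - 1)) w →
      (∀ x, ∀ s ∈ Set.Icc (p₀.2 - 1) 0, ‖w x s‖ ≤ 1) →
      ∀ p ∈ U, p.2 ≤ 0 → ‖w p.1 p.2 - w p₀.1 p₀.2‖ ≤ ε := by
  obtain ⟨S, hS⟩ : ∃ S, S = p₀.2 - 1 := ⟨_, rfl⟩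
  rw [← hS]
  have hS1 : S < p₀.2 := by linarith
  have hheat := tendsto_integral_abs_heatKer_sub n hS1
  have htot : Tendsto (fun p : Euc n × ℝ => ∑ i : Fin n,
      ((∫ y : Euc n, |heatKer n (p.1 - y) (p.2 - S) - heatKer n (p₀.1 - y) (p₀.2 - S)|)
        + ∑ j, ∑ k, ∫ q, |Kcut n 2 i j k (p - q) - Kcut n 2 i j k (p₀ - q)|)) (𝓝 p₀) (𝓝 0) := by
    have h := tendsto_finsetSum (Finset.univ : Finset (Fin n)) fun i _ => hheat.add
      (tendsto_finsetSum (Finset.univ : Finset (Fin n)) fun j _ =>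
        tendsto_finsetSum (Finset.univ : Finset (Fin n)) fun k _ =>
          tendsto_integral_abs_sub_translate (integrable_Kcut n hn 2 i j k) p₀)
    simpa using h
  have hnear : ∀ᶠ p : Euc n × ℝ in 𝓝 p₀, S < p.2 ∧ p.2 < S + 2 :=
    ((continuous_snd.tendsto p₀).eventually (lt_mem_nhds hS1)).and
      ((continuous_snd.tendsto p₀).eventually (gt_mem_nhds (by linarith)))
  refine ⟨_, hnear.and (htot.eventually (gt_mem_nhds hε)), fun w b hw hb hmild hB p hp hp0 => ?_⟩
  obtain ⟨⟨h1, h2⟩, h3⟩ := hp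
  refine ((norm_le_sum_abs n _).trans (Finset.sum_le_sum fun i _ => ?_)).trans h3.le
  have hB' : ∀ x, ∀ s ∈ Set.Ioc S 0, ‖w x s‖ ≤ 1 := fun x s hs => hB x s ⟨hs.1.le, hs.2⟩
  have e1 := mild_eq_duhamel n hn (L := 2) hw hmild ⟨h1, hp0.trans_lt hb⟩ hp0 hB'
    (by linarith) p.1 i
  have e2 := mild_eq_duhamel n hn (L := 2) hw hmild (t := p₀.2) ⟨hS1, hp₀.trans_lt hb⟩ hp₀
    hB' (by linarith) p₀.1 i
  have hS0 : S ∈ Set.Icc S 0 := ⟨le_rfl, by linarith⟩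
  have b1 := abs_heat_sub_le n (f := fun y => w y S i)
    (measurable_slice n hw S i)
    (fun y => (abs_coord_le n _ i).trans (hB y S hS0))
    p.1 p₀.1 (sub_pos.2 h1) (sub_pos.2 hS1)
  have b2 := abs_duhamel_sub_le n hn 2 hw hB' i p p₀
  rw [PiLp.sub_apply, e1, e2, sub_sub_sub_comm]
  exact (abs_sub _ _).trans (add_le_add b1 b2)

theorem exists_subseq_tendsto_of_equicontinuous {X : Type*} [TopologicalSpace X]
    [TopologicalSpace.SeparableSpace X] {n : ℕ} {f : ℕ → X → Euc n} (hb : ∀ p, ∀ᶠ k in atTop, ‖f k p‖ ≤ 1)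
    (he : ∀ p₀, ∀ ε > 0, ∃ U ∈ 𝓝 p₀, ∀ᶠ k in atTop, ∀ p ∈ U, ‖f k p - f k p₀‖ ≤ ε) :
    ∃ φ : ℕ → ℕ, StrictMono φ ∧ ∃ g : X → Euc n, Continuous g ∧
      ∀ p, Tendsto (fun k => f (φ k) p) atTop (𝓝 (g p)) := by
  classical
  obtain ⟨D, hDc, hDd⟩ := TopologicalSpace.exists_countable_dense X
  have : Countable D := hDc.to_subtype
  let F : ℕ → D → Euc n := fun k d => if ‖f k d‖ ≤ 1 then f k d else 0
  have hF : ∀ k, F k ∈ Set.pi Set.univ fun _ : D => Metric.closedBall (0 : Euc n) 1 := by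
    intro k d _
    simp only [F]
    split_ifs with h
    · simpa using h
    · simp
  obtain ⟨a, -, φ, hφ, ha⟩ :=
    (isCompact_univ_pi fun _ : D => isCompact_closedBall (0 : Euc n) 1).tendsto_subseq hF
  rw [tendsto_pi_nhds] at ha
  have hφt := hφ.tendsto_atTop
  have hD : ∀ d : D, Tendsto (fun k => f (φ k) d) atTop (𝓝 (a d)) := by
    intro d
    refine (ha d).congr' ((hφt.eventually (hb d)).mono fun k hk => ?_)
    exact if_pos hk
  have hlim : ∀ p, ∃ y, Tendsto (fun k => f (φ k) p) atTop (𝓝 y) := by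
    intro p
    refine cauchySeq_tendsto_of_complete (Metric.cauchySeq_iff'.2 fun ε hε => ?_)
    obtain ⟨U, hU, hUe⟩ := he p (ε / 4) (by positivity)
    obtain ⟨d, hdU, hdD⟩ := mem_closure_iff_nhds.1 (hDd p) U hU
    have h1 := (Metric.tendsto_nhds.1 (hD ⟨d, hdD⟩)) (ε / 8) (by positivity)
    obtain ⟨N, hN⟩ := eventually_atTop.1 ((hφt.eventually hUe).and h1)
    refine ⟨N, fun m hm => ?_⟩
    have e1 := (hN m hm).1 d hdU
    have e2 := (hN N le_rfl).1 d hdU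
    have e3 := (hN m hm).2
    have e4 := (hN N le_rfl).2
    rw [← dist_eq_norm] at e1 e2
    have t1 := dist_triangle4 (f (φ m) p) (f (φ m) d) (f (φ N) d) (f (φ N) p)
    have t2 := dist_triangle_right (f (φ m) d) (f (φ N) d) (a ⟨d, hdD⟩)
    rw [dist_comm (f (φ m) p) (f (φ m) d)] at t1
    change dist (f (φ m) d) (a ⟨d, hdD⟩) < _ at e3
    change dist (f (φ N) d) (a ⟨d, hdD⟩) < _ at e4
    linarith
  choose g hg using hlim
  refine ⟨φ, hφ, g, continuous_iff_continuousAt.2 fun p₀ => ?_, hg⟩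
  rw [ContinuousAt, Metric.tendsto_nhds]
  intro ε hε
  obtain ⟨U, hU, hUe⟩ := he p₀ (ε / 2) (by positivity)
  filter_upwards [hU] with p hp
  have := le_of_tendsto ((hg p).sub (hg p₀)).norm ((hφt.eventually hUe).mono fun k hk => hk p hp)
  rw [dist_eq_norm]
  linarith

theorem isMildNS_of_tendsto {n : ℕ} (hn : 2 ≤ n) {S : ℝ} {v : ℕ → Euc n → ℝ → Euc n}
    {w : Euc n → ℝ → Euc n} (hv : ∀ k, Measurable (fun q : Euc n × ℝ => v k q.1 q.2))
    (hw : Measurable (fun q : Euc n × ℝ => w q.1 q.2))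
    (hmild : ∀ᶠ k in atTop, ∃ b > 0, IsMildNS n S b (fun x => v k x S) (v k))
    (hbd : ∀ᶠ k in atTop, ∀ x, ∀ s ∈ Set.Icc S 0, ‖v k x s‖ ≤ 1)
    (hwbd : ∀ x, ∀ s ∈ Set.Icc S 0, ‖w x s‖ ≤ 1)
    (hlim : ∀ x, ∀ s ≤ 0, Tendsto (fun k => v k x s) atTop (𝓝 (w x s))) :
    IsMildNS n S 0 (fun x => w x S) w := by
  intro x t ht i
  have hS0 : S < 0 := ht.1.trans ht.2
  have hcoord : ∀ y, ∀ s ≤ 0, ∀ j, Tendsto (fun k => v k y s j) atTop (𝓝 (w y s j)) :=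
    fun y s hs j => ((EuclideanSpace.proj (𝕜 := ℝ) j).continuous.tendsto _).comp (hlim y s hs)
  have hwbd' : ∀ x, ∀ s ∈ Set.Ioc S 0, ‖w x s‖ ≤ 1 := fun x s hs => hwbd x s ⟨hs.1.le, hs.2⟩
  rw [mild_nonlinear_eq n hn (L := -S) hw hwbd' i x ht.2.le (by linarith [ht.2])]
  have hpos : 0 < t - S := sub_pos.2 ht.1
  have h1 : Tendsto (fun k => ∫ y : Euc n, heatKer n (x - y) (t - S) * v k y S i) atTop
      (𝓝 (∫ y : Euc n, heatKer n (x - y) (t - S) * w y S i)) := by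
    refine tendsto_integral_filter_of_dominated_convergence
      (fun y => heatKer n (x - y) (t - S)) (.of_forall fun k => ?_) ?_
      (integrable_heatKer_sub n x hpos) (.of_forall fun y => ?_)
    · exact (((measurable_heatKer_left n _).comp (measurable_const.sub measurable_id)).mul
        (measurable_slice n (hv k) S i)).aestronglyMeasurable
    · filter_upwards [hbd] with k hk
      refine .of_forall fun y => ?_
      rw [norm_mul, Real.norm_eq_abs, abs_of_pos (heatKer_pos n _ hpos)]
      exact mul_le_of_le_one_right (heatKer_pos n _ hpos).le
        ((abs_coord_le n _ i).trans (hk y S ⟨le_rfl, hS0.le⟩))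
    · exact (hcoord y S hS0.le i).const_mul _
  have h2 : Tendsto (fun k => ∫ q, duhamel n (-S) S 0 (v k) i (x, t) q) atTop
      (𝓝 (∫ q, duhamel n (-S) S 0 w i (x, t) q)) := by
    have hK := fun j k => ((integrable_Kcut n hn (-S) i j k).comp_sub_left (x, t)).abs
    refine tendsto_integral_filter_of_dominated_convergence
      (fun q => ∑ j, ∑ k, |Kcut n (-S) i j k ((x, t) - q)|) ?_ ?_
      (integrable_finsetSum _ fun j _ => integrable_finsetSum _ fun k _ => hK j k)
      (.of_forall fun q => ?_)
    · filter_upwards [hbd] with k hk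
      exact (integrable_duhamel n hn (-S) (hv k)
        (fun x s hs => hk x s ⟨hs.1.le, hs.2⟩) i (x, t)).1
    · filter_upwards [hbd] with k hk
      refine .of_forall fun q => ?_
      refine (Finset.abs_sum_le_sum_abs _ _).trans (Finset.sum_le_sum fun j _ => ?_)
      refine (Finset.abs_sum_le_sum_abs _ _).trans (Finset.sum_le_sum fun l _ => ?_)
      rw [abs_mul]
      refine mul_le_of_le_one_right (abs_nonneg _) ?_
      simpa using abs_quadCut_le n (t₀ := S) (t₁ := 0) (w := v k)
        (fun x s hs => hk x s ⟨hs.1.le, hs.2⟩) j l q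
    · refine tendsto_finsetSum _ fun j _ => tendsto_finsetSum _ fun l _ => Tendsto.const_mul _ ?_
      unfold quadCut
      split_ifs with h
      · exact (hcoord _ _ h.2 l).mul (hcoord _ _ h.2 j)
      · exact tendsto_const_nhds
  refine tendsto_nhds_unique (hcoord x t ht.2.le i) ((h1.sub h2).congr' ?_)
  filter_upwards [hmild, hbd] with k ⟨b, hb, hk⟩ hkb
  exact (mild_eq_duhamel n hn (L := -S) (hv k) hk ⟨ht.1, ht.2.trans hb⟩ ht.2.le
    (fun x s hs => hkb x s ⟨hs.1.le, hs.2⟩) (by linarith [ht.2]) x i).symm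

theorem exists_equicontinuous_mild_at {n : ℕ} (hn : 2 ≤ n) (x₀ : Euc n) (t₀ : ℝ) (ht₀ : t₀ ≤ 0)
    {ε : ℝ} (hε : 0 < ε) : ∃ U ∈ 𝓝 (x₀, t₀), ∀ (w : Euc n → ℝ → Euc n) (b : ℝ),
      Measurable (fun q : Euc n × ℝ => w q.1 q.2) → 0 < b →
      IsMildNS n (t₀ - 1) b (fun x => w x (t₀ - 1)) w →
      (∀ x, ∀ s ∈ Set.Icc (t₀ - 1) 0, ‖w x s‖ ≤ 1) →
      ∀ x t, (x, t) ∈ U → t ≤ 0 → ‖w x t - w x₀ t₀‖ ≤ ε := by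
  obtain ⟨U, hU, h⟩ := exists_equicontinuous_mild n hn (x₀, t₀) ht₀ hε
  exact ⟨U, hU, fun w b h1 h2 h3 h4 x t hx ht => h w b h1 h2 h3 h4 (x, t) hx ht⟩

theorem equicontinuous_truncated {n : ℕ} (hn : 2 ≤ n) {v : ℕ → Euc n → ℝ → Euc n}
    (hv : ∀ k, Measurable (fun q : Euc n × ℝ => v k q.1 q.2))
    (hmild : ∀ S < 0, ∀ᶠ k in atTop, ∃ b > 0, IsMildNS n S b (fun x => v k x S) (v k))
    (hbd : ∀ S < 0, ∀ᶠ k in atTop, ∀ x, ∀ s ∈ Set.Icc S 0, ‖v k x s‖ ≤ 1)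
    (p₀ : Euc n × ℝ) (ε : ℝ) (hε : ε > 0) : ∃ U ∈ 𝓝 p₀, ∀ᶠ k in atTop, ∀ p ∈ U,
      ‖v k p.1 (min p.2 0) - v k p₀.1 (min p₀.2 0)‖ ≤ ε := by
  obtain ⟨x₀, t⟩ := p₀
  obtain ⟨τ, hτ⟩ : ∃ τ, τ = min t 0 := ⟨_, rfl⟩
  have hle : τ ≤ 0 := hτ ▸ min_le_right _ _
  have hlt : τ - 1 < 0 := by linarith
  obtain ⟨U, hU, hUe⟩ := exists_equicontinuous_mild_at hn x₀ τ hle hε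
  have hc : Continuous fun p : Euc n × ℝ => (p.1, min p.2 0) := by fun_prop
  have hU' : (fun p : Euc n × ℝ => (p.1, min p.2 0)) ⁻¹' U ∈ 𝓝 (x₀, t) := by
    refine hc.continuousAt.preimage_mem_nhds ?_
    simpa only [← hτ] using hU
  refine ⟨_, hU', ?_⟩
  filter_upwards [hmild _ hlt, hbd _ hlt] with k ⟨b, hb, hk⟩ hkb p hp
  simp only [← hτ]
  exact hUe (v k) b (hv k) hb hk hkb p.1 (min p.2 0) hp (min_le_right _ _)

theorem exists_ancient_of_sequence {n : ℕ} (hn : 2 ≤ n) {v : ℕ → Euc n → ℝ → Euc n}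
    (hv : ∀ k, Measurable (fun q : Euc n × ℝ => v k q.1 q.2))
    (hmild : ∀ S < 0, ∀ᶠ k in atTop, ∃ b > 0, IsMildNS n S b (fun x => v k x S) (v k))
    (hbd : ∀ S < 0, ∀ᶠ k in atTop, ∀ x, ∀ s ∈ Set.Icc S 0, ‖v k x s‖ ≤ 1)
    (h0 : Tendsto (fun k => ‖v k 0 0‖) atTop (𝓝 1)) :
    ∃ w : Euc n → ℝ → Euc n, IsAncientMild n w ∧ (∀ x : Euc n, ∀ t ≤ (0:ℝ), ‖w x t‖ ≤ 1) ∧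
      ContinuousOn (fun q : Euc n × ℝ => w q.1 q.2) (Set.univ ×ˢ Set.Iic 0) ∧ ‖w 0 0‖ = 1 := by
  have hb : ∀ p : Euc n × ℝ, ∀ᶠ k in atTop, ‖v k p.1 (min p.2 0)‖ ≤ 1 := by
    intro p
    have hlt : min p.2 0 - 1 < 0 := by linarith [min_le_right p.2 0]
    filter_upwards [hbd _ hlt] with k hk
    exact hk p.1 _ ⟨by linarith, min_le_right _ _⟩
  obtain ⟨φ, hφ, g, hg, hlim⟩ := exists_subseq_tendsto_of_equicontinuous
    (f := fun k (p : Euc n × ℝ) => v k p.1 (min p.2 0)) hb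
    (equicontinuous_truncated hn hv hmild hbd)
  have hφt := hφ.tendsto_atTop
  have hgbd : ∀ p, ‖g p‖ ≤ 1 := fun p => le_of_tendsto (hlim p).norm (hφt.eventually (hb p))
  have hlim' : ∀ x, ∀ s ≤ 0, Tendsto (fun k => v (φ k) x s) atTop (𝓝 (g (x, s))) := by
    intro x s hs
    simpa [min_eq_left hs] using hlim (x, s)
  refine ⟨fun x s => g (x, s), ⟨hg.measurable, ⟨1, fun x t _ => hgbd _⟩, fun l => -(l : ℝ) - 1,
    ?_, fun l => ?_⟩, fun x t _ => hgbd _, hg.continuousOn, ?_⟩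
  · exact tendsto_atBot_add_const_right _ _
      (tendsto_neg_atTop_atBot.comp tendsto_natCast_atTop_atTop)
  · have hl : -(l : ℝ) - 1 < 0 := by linarith [(Nat.cast_nonneg l : (0 : ℝ) ≤ l)]
    exact ⟨hl, isMildNS_of_tendsto hn (fun k => hv (φ k)) hg.measurable
      (hφt.eventually (hmild _ hl)) (hφt.eventually (hbd _ hl)) (fun x s _ => hgbd _) hlim'⟩
  · exact tendsto_nhds_unique (hlim' 0 0 le_rfl).norm (h0.comp hφt)

/-- A point and a bound `m` almost attained there among all earlier times. -/
theorem exists_almost_maximum {n : ℕ} {T : ℝ} (hT : 0 < T) {u : Euc n → ℝ → Euc n}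
    (hlocbd : ∀ T' ∈ Set.Ioo (0:ℝ) T, ∃ M : ℝ, ∀ x : Euc n,
      ∀ t ∈ Set.Ioo (0:ℝ) T', ‖u x t‖ ≤ M)
    (hblow : ∀ M : ℝ, ∃ x : Euc n, ∃ t ∈ Set.Ioo (0:ℝ) T, M < ‖u x t‖) (k : ℕ) :
    ∃ x : Euc n, ∃ t m : ℝ, t ∈ Set.Ico (T / 2) T ∧ (k : ℝ) + 1 ≤ m ∧
      (1 - 1 / ((k : ℝ) + 2)) * m ≤ ‖u x t‖ ∧ ∀ y, ∀ s ∈ Set.Ioc 0 t, ‖u y s‖ ≤ m := by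
  obtain ⟨N, hN⟩ := hlocbd (3 * T / 4) ⟨by linarith, by linarith⟩
  have hk0 : (0 : ℝ) ≤ k := Nat.cast_nonneg k
  obtain ⟨x₁, t₁, ht₁, hx₁⟩ := hblow (2 * |N| + k + 1)
  obtain ⟨B, hB⟩ := hlocbd ((t₁ + T) / 2) ⟨by linarith [ht₁.1], by linarith [ht₁.2]⟩
  let A : Set ℝ := {r | ∃ y, ∃ s ∈ Set.Ioc 0 t₁, r = ‖u y s‖}
  have hbdd : BddAbove A := by
    refine ⟨B, ?_⟩
    rintro r ⟨y, s, hs, rfl⟩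
    exact hB y s ⟨hs.1, by linarith [hs.2, ht₁.2]⟩
  have hmem : ‖u x₁ t₁‖ ∈ A := ⟨x₁, t₁, ⟨ht₁.1, le_rfl⟩, rfl⟩
  have hsup := le_csSup hbdd hmem
  have habs := abs_nonneg N
  have hm0 : 0 < sSup A := by linarith
  have hfrac : (0 : ℝ) < 1 / ((k : ℝ) + 2) := by positivity
  have hfrac' : 1 / ((k : ℝ) + 2) ≤ 1 / 2 := by
    apply one_div_le_one_div_of_le <;> linarith
  obtain ⟨r, ⟨x, t, ht, rfl⟩, hr⟩ := exists_lt_of_lt_csSup ⟨_, hmem⟩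
    (show (1 - 1 / ((k : ℝ) + 2)) * sSup A < sSup A by nlinarith)
  have hbig : |N| < ‖u x t‖ := by nlinarith
  have htT : T / 2 ≤ t := by
    by_contra! hlt
    exact absurd (hN x t ⟨ht.1, by linarith⟩) (not_le.2 ((le_abs_self N).trans_lt hbig))
  exact ⟨x, t, sSup A, ⟨htT, ht.2.trans_lt ht₁.2⟩, by linarith, hr.le, fun y s hs =>
    le_csSup hbdd ⟨y, s, ⟨hs.1, hs.2.trans ht.2⟩, rfl⟩⟩

theorem measurable_rescale {n : ℕ} {u : Euc n → ℝ → Euc n}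
    (hu : Measurable fun q : Euc n × ℝ => u q.1 q.2) (x₀ : Euc n) (t₀ lam : ℝ) :
    Measurable fun q : Euc n × ℝ => lam • u (x₀ + lam • q.1) (t₀ + lam ^ 2 * q.2) := by
  have hc : Continuous fun q : Euc n × ℝ => (x₀ + lam • q.1, t₀ + lam ^ 2 * q.2) := by fun_prop
  have := Measurable.comp (g := fun q : Euc n × ℝ => u q.1 q.2)
    (f := fun q : Euc n × ℝ => (x₀ + lam • q.1, t₀ + lam ^ 2 * q.2)) hu hc.measurable
  exact Measurable.const_smul this lam

theorem IsMildNS.rescale_restart {n : ℕ} (hn : 2 ≤ n) {T : ℝ} {u₀ : Euc n → Euc n}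
    {u : Euc n → ℝ → Euc n} (hmeas0 : Measurable u₀) (hbd0 : ∃ N : ℝ, ∀ x : Euc n, ‖u₀ x‖ ≤ N)
    (hmeas : Measurable (fun q : Euc n × ℝ => u q.1 q.2)) (hmild : IsMildNS n 0 T u₀ u)
    (hlocbd : ∀ T' ∈ Set.Ioo (0:ℝ) T, ∃ M : ℝ, ∀ x : Euc n,
      ∀ t ∈ Set.Ioo (0:ℝ) T', ‖u x t‖ ≤ M)
    (x₀ : Euc n) {t₀ lam S : ℝ} (hlam : 0 < lam) (hS : S < 0) (ht₀ : t₀ < T)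
    (hpos : 0 < t₀ + lam ^ 2 * S) {v : Euc n → ℝ → Euc n}
    (hv : v = fun y s => lam • u (x₀ + lam • y) (t₀ + lam ^ 2 * s)) :
    ∃ b > 0, IsMildNS n S b (fun x => v x S) v := by
  obtain ⟨N, hN⟩ := hbd0
  have hl2 : 0 < lam ^ 2 := by positivity
  have hlS : lam ^ 2 * S < 0 := mul_neg_of_pos_of_neg hl2 hS
  have hB : ∀ T' ∈ Set.Ioo 0 T, ∃ M, ∀ x, ∀ t ∈ Set.Ioc 0 T', ‖u x t‖ ≤ M := by
    intro T' hT'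
    obtain ⟨M, hM⟩ := hlocbd ((T' + T) / 2) ⟨by linarith [hT'.1, hT'.2], by linarith [hT'.2]⟩
    exact ⟨M, fun x t ht => hM x t ⟨ht.1, by linarith [ht.2, hT'.2]⟩⟩
  have h := (IsMildNS.restart hn hmeas0 hN hmeas hB hmild
    (t₀ := t₀ + lam ^ 2 * S) ⟨hpos, by linarith⟩).rescale hn x₀ t₀ hlam
  have hstart : (t₀ + lam ^ 2 * S - t₀) / lam ^ 2 = S := by
    rw [add_sub_cancel_left, mul_div_cancel_left₀ _ hl2.ne']
  rw [hstart] at h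
  subst hv
  exact ⟨(T - t₀) / lam ^ 2, div_pos (by linarith) hl2, h⟩

/-- Proposition 6.3: a finite-time singularity arising from a mild solution generates a
bounded ancient mild solution v with |v| ≤ 1 and |v(0,0)| = 1; in particular v is not
identically zero. -/
theorem singularity_generates_ancient (n : ℕ) (hn : 2 ≤ n) (T : ℝ) (hT : 0 < T)
    (u₀ : Euc n → Euc n) (u : Euc n → ℝ → Euc n)
    (hmeas0 : Measurable u₀) (hbd0 : ∃ N : ℝ, ∀ x : Euc n, ‖u₀ x‖ ≤ N)
    -- u₀ is divergence-free in the sense of distributions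
    (hdiv : ∀ ψ : Euc n → ℝ, ContDiff ℝ (⊤ : ℕ∞) ψ → HasCompactSupport ψ →
      (∫ x : Euc n, ∑ i : Fin n, u₀ x i * pd n i ψ x) = 0)
    (hmeas : Measurable (fun q : Euc n × ℝ => u q.1 q.2))
    -- u is a mild solution with datum u₀, bounded on ℝⁿ × (0,T') for every T' < T
    (hmild : IsMildNS n 0 T u₀ u)
    (hlocbd : ∀ T' ∈ Set.Ioo (0:ℝ) T, ∃ M : ℝ, ∀ x : Euc n,
      ∀ t ∈ Set.Ioo (0:ℝ) T', ‖u x t‖ ≤ M)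
    -- ‖u‖_{L^∞(ℝⁿ×(0,T'))} → ∞ as T' ↗ T, i.e. u is unbounded on ℝⁿ × (0,T)
    (hblow : ∀ M : ℝ, ∃ x : Euc n, ∃ t ∈ Set.Ioo (0:ℝ) T, M < ‖u x t‖) :
    ∃ v : Euc n → ℝ → Euc n, IsAncientMild n v ∧
      (∀ x : Euc n, ∀ t ≤ (0:ℝ), ‖v x t‖ ≤ 1) ∧
      -- v extends continuously up to time 0 (smooth representative)
      ContinuousOn (fun q : Euc n × ℝ => v q.1 q.2) (Set.univ ×ˢ Set.Iic 0) ∧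
      ‖v 0 0‖ = 1 := by
  choose x t m ht hm hattain hmax using exists_almost_maximum hT hlocbd hblow
  have hm0 : ∀ k, 0 < m k := fun k => by
    linarith [hm k, (Nat.cast_nonneg k : (0 : ℝ) ≤ k)]
  have hlam0 : ∀ k, 0 < (m k)⁻¹ := fun k => inv_pos.2 (hm0 k)
  obtain ⟨v, hv⟩ : ∃ v : ℕ → Euc n → ℝ → Euc n, ∀ k, v k = fun y s =>
      (m k)⁻¹ • u (x k + (m k)⁻¹ • y) (t k + (m k)⁻¹ ^ 2 * s) := ⟨_, fun _ => rfl⟩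
  have hmtop : Tendsto m atTop atTop :=
    tendsto_atTop_mono hm (tendsto_atTop_add_const_right _ _ tendsto_natCast_atTop_atTop)
  have hlam : Tendsto (fun k => (m k)⁻¹ ^ 2) atTop (𝓝 0) := by
    simpa using (tendsto_inv_atTop_zero.comp hmtop).pow 2
  have hstart : ∀ S : ℝ, ∀ᶠ k in atTop, 0 < t k + (m k)⁻¹ ^ 2 * S := by
    intro S
    have hS : Tendsto (fun k => (m k)⁻¹ ^ 2 * S) atTop (𝓝 0) := by
      simpa using hlam.mul_const S
    filter_upwards [hS.eventually (lt_mem_nhds (show -(T / 2) < 0 by linarith))] with k hk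
    linarith [(ht k).1]
  have hbd : ∀ k, ∀ s ≤ 0, 0 < t k + (m k)⁻¹ ^ 2 * s → ∀ y, ‖v k y s‖ ≤ 1 := by
    intro k s hs hpos y
    have hle : (m k)⁻¹ ^ 2 * s ≤ 0 := mul_nonpos_of_nonneg_of_nonpos (by positivity) hs
    have h1 := hmax k (x k + (m k)⁻¹ • y) _ ⟨hpos, by linarith⟩
    simp only [hv, norm_smul, Real.norm_eq_abs, abs_of_pos (hlam0 k)]
    exact (mul_le_mul_of_nonneg_left h1 (hlam0 k).le).trans_eq (inv_mul_cancel₀ (hm0 k).ne')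
  refine exists_ancient_of_sequence hn (v := v) (fun k => ?_) (fun S hS => ?_) (fun S hS => ?_) ?_
  · simp only [hv]
    exact measurable_rescale hmeas (x k) (t k) (m k)⁻¹
  · filter_upwards [hstart S] with k hk
    exact IsMildNS.rescale_restart hn hmeas0 hbd0 hmeas hmild hlocbd (x k) (hlam0 k) hS
      (ht k).2 hk (hv k)
  · filter_upwards [hstart S] with k hk y s hs
    have := mul_le_mul_of_nonneg_left hs.1 (sq_nonneg (m k)⁻¹)
    exact hbd k s hs.2 (by linarith) y
  · have hlow : Tendsto (fun k : ℕ => 1 - 1 / ((k : ℝ) + 2)) atTop (𝓝 1) := by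
      have h := (tendsto_const_nhds (x := (1 : ℝ))).div_atTop
        (tendsto_atTop_add_const_right atTop (2 : ℝ) (tendsto_natCast_atTop_atTop (R := ℝ)))
      simpa using h.const_sub 1
    refine tendsto_of_tendsto_of_tendsto_of_le_of_le hlow tendsto_const_nhds (fun k => ?_)
      (fun k => hbd k 0 le_rfl (by linarith [(ht k).1]) 0)
    simp only [hv, norm_smul, Real.norm_eq_abs, abs_of_pos (hlam0 k), smul_zero, add_zero, mul_zero]
    rw [inv_mul_eq_div, le_div_iff₀ (hm0 k)]
    exact hattain k

end
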